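/- arXiv:0804.4889 — 11 statements merged into one kernel-verified Lean document; each statement's English description precedes it below -/
import Mathlib

section
/- Let T be a positive contraction on L¹. Then T is strongly stable if and only if T is mean ergodic and the only u ∈ L¹ with Tu = u is u = 0. -/
open MeasureTheory Filter

/-- The norm of a nonnegative element of `L¹` is its integral. -/
lemma L1_norm_eq_integralCLM_of_nonneg {E : Type*} [MeasurableSpace E] {m : Measure E}
    {u : Lp ℝ 1 m} (hu : 0 ≤ u) : ‖u‖ = L1.integralCLM u := by
  rw [L1.norm_eq_integral_norm, ← L1.integral_eq, L1.integral_eq_integral]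
  refine integral_congr_ae ?_
  filter_upwards [(Lp.coeFn_nonneg u).2 hu] with x hx
  exact Real.norm_of_nonneg hx

/-- If the orbit averages `N⁻¹ ∑_{n<N} Tⁿ u` of a contraction converge to `v`, then `T v = v`. -/
lemma apply_eq_of_tendsto_average {X : Type*} [NormedAddCommGroup X] [NormedSpace ℝ X]
    (T : X →L[ℝ] X) (hT : ∀ u, ‖T u‖ ≤ ‖u‖) {u v : X}
    (h : Tendsto (fun N : ℕ => (N : ℝ)⁻¹ • ∑ n ∈ Finset.range N, (T ^ n) u) atTop (nhds v)) :
    T v = v := by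
  have hpow : ∀ n, ‖(T ^ n) u‖ ≤ ‖u‖ := fun n => by
    induction n with
    | zero => simp
    | succ n ih =>
      rw [pow_succ']
      exact (hT _).trans ih
  have hsub := ((T.continuous.tendsto v).comp h).sub h
  have hzero : Tendsto (fun N : ℕ => (N : ℝ)⁻¹ • ((T ^ N) u - u)) atTop (nhds 0) := by
    refine squeeze_zero_norm (a := fun N : ℕ => (N : ℝ)⁻¹ * (‖u‖ + ‖u‖)) (fun N => ?_) ?_
    · rw [norm_smul, norm_inv, Real.norm_natCast]
      gcongr
      exact (norm_sub_le _ _).trans (by gcongr; exact hpow N)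
    · simpa using (tendsto_inv_atTop_nhds_zero_nat (𝕜 := ℝ)).mul_const (‖u‖ + ‖u‖)
  refine sub_eq_zero.1 (tendsto_nhds_unique hsub (hzero.congr fun N => ?_))
  have hsum : T (∑ n ∈ Finset.range N, (T ^ n) u) - ∑ n ∈ Finset.range N, (T ^ n) u
      = (T ^ N) u - u := by
    rw [map_sum, ← Finset.sum_sub_distrib]
    have := Finset.sum_range_sub (fun n => (T ^ n) u) N
    simpa [pow_succ'] using this
  simp only [Function.comp_apply, map_smul, ← smul_sub, hsum]

/-- A positive contraction on `L¹` whose averages along the orbit of a nonnegative `u` tend to `0`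
satisfies `‖Tⁿ u‖ → 0`. -/
lemma tendsto_norm_pow_of_tendsto_average {E : Type*} [MeasurableSpace E] {m : Measure E}
    (T : Lp ℝ 1 m →L[ℝ] Lp ℝ 1 m) (hTpos : ∀ u : Lp ℝ 1 m, 0 ≤ u → 0 ≤ T u)
    (hTcontr : ∀ u : Lp ℝ 1 m, ‖T u‖ ≤ ‖u‖) {u : Lp ℝ 1 m} (hu : 0 ≤ u)
    (h : Tendsto (fun N : ℕ => (N : ℝ)⁻¹ • ∑ n ∈ Finset.range N, (T ^ n) u) atTop (nhds 0)) :
    Tendsto (fun n : ℕ => ‖(T ^ n) u‖) atTop (nhds 0) := by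
  have hpos : ∀ n, 0 ≤ (T ^ n) u := fun n => by
    induction n with
    | zero => simpa using hu
    | succ n ih =>
      rw [pow_succ']
      exact hTpos _ ih
  have hanti : Antitone fun n : ℕ => ‖(T ^ n) u‖ := antitone_nat_of_succ_le fun n => by
    rw [pow_succ']
    exact hTcontr _
  have hint := ((L1.integralCLM (E := ℝ) (μ := m)).continuous.tendsto 0).comp h
  rw [map_zero] at hint
  refine squeeze_zero' (.of_forall fun _ => norm_nonneg _) ?_ hint
  filter_upwards [eventually_gt_atTop 0] with N hN
  have hN' : (0 : ℝ) < N := by exact_mod_cast hN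
  simp only [Function.comp_apply, map_smul, map_sum, smul_eq_mul,
    ← L1_norm_eq_integralCLM_of_nonneg (hpos _)]
  rw [le_inv_mul_iff₀ hN']
  simpa using Finset.card_nsmul_le_sum (Finset.range N) (fun n => ‖(T ^ n) u‖) ‖(T ^ N) u‖
    fun n hn => hanti (Finset.mem_range.1 hn).le

/-- Let `T` be a positive contraction on `L¹`. Then `T` is strongly stable
if and only if `T` is mean ergodic and the only `u ∈ L¹` with `T u = u` is `u = 0`. -/
theorem strongly_stable_iff_mean_ergodic_and_no_fixed_points
    {E : Type*} [MeasurableSpace E] (m : Measure E) [SigmaFinite m]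
    (T : Lp ℝ 1 m →L[ℝ] Lp ℝ 1 m)
    (hTpos : ∀ u : Lp ℝ 1 m, 0 ≤ u → 0 ≤ T u)
    (hTcontr : ∀ u : Lp ℝ 1 m, ‖T u‖ ≤ ‖u‖) :
    (∀ u : Lp ℝ 1 m, Tendsto (fun n : ℕ => ‖(T ^ n) u‖) atTop (nhds 0)) ↔
      ((∀ u : Lp ℝ 1 m, ∃ v : Lp ℝ 1 m,
          Tendsto (fun N : ℕ => (N : ℝ)⁻¹ • ∑ n ∈ Finset.range N, (T ^ n) u) atTop (nhds v)) ∧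
        (∀ u : Lp ℝ 1 m, T u = u → u = 0)) := by
  refine ⟨fun h => ⟨fun u => ⟨0, ?_⟩, fun u hu => ?_⟩, fun ⟨herg, hfix⟩ u => ?_⟩
  · exact (tendsto_zero_iff_norm_tendsto_zero.2 (h u)).cesaro_smul
  · have hpow : ∀ n, (T ^ n) u = u := fun n => by
      induction n with
      | zero => simp
      | succ n ih => rw [pow_succ', mul_apply_eq_comp, ih, hu]
    have hconst := h u
    simp only [hpow] at hconst
    exact norm_eq_zero.1 (tendsto_nhds_unique tendsto_const_nhds hconst)
  · have hnonneg : ∀ w : Lp ℝ 1 m, 0 ≤ w →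
        Tendsto (fun n : ℕ => ‖(T ^ n) w‖) atTop (nhds 0) := fun w hw => by
      obtain ⟨v, hv⟩ := herg w
      have hv0 := hfix v (apply_eq_of_tendsto_average T hTcontr hv)
      exact tendsto_norm_pow_of_tendsto_average T hTpos hTcontr hw (hv0 ▸ hv)
    have hsum := (hnonneg _ (posPart_nonneg u)).add (hnonneg _ (negPart_nonneg u))
    rw [add_zero] at hsum
    refine squeeze_zero (fun _ => norm_nonneg _) (fun n => ?_) hsum
    conv_lhs => rw [← posPart_sub_negPart u, map_sub]
    exact norm_sub_le _ _
end

section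
/- Let T be a positive contraction on L¹. If there exists u ∈ L¹ with u ≥ 0 m-a.e., u > 0 m-a.e., and ‖Tⁿu‖ → 0 as n → ∞, then ‖Tⁿv‖ → 0 as n → ∞ for every v ∈ L¹, i.e. T is strongly stable. -/
open MeasureTheory Filter

/-- If `u > 0` a.e. and `v ≥ 0` in `L¹`, the truncations `v ⊓ k • u` converge to `v` in norm. -/
theorem tendsto_norm_sub_inf_natCast_smul {E : Type*} [MeasurableSpace E] {m : Measure E}
    {u v : Lp ℝ 1 m} (hu : ∀ᵐ x ∂m, 0 < u x) (hv : 0 ≤ v) :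
    Tendsto (fun k : ℕ => ‖v - v ⊓ (k : ℝ) • u‖) atTop (nhds 0) := by
  have hcoe : ∀ᵐ x ∂m, ∀ k : ℕ, (v - v ⊓ (k : ℝ) • u) x = v x - min (v x) (k * u x) := by
    rw [ae_all_iff]
    intro k
    filter_upwards [Lp.coeFn_sub v (v ⊓ (k : ℝ) • u), Lp.coeFn_inf v ((k : ℝ) • u),
      Lp.coeFn_smul (k : ℝ) u] with x h₁ h₂ h₃
    rw [h₁, Pi.sub_apply, h₂, Pi.inf_apply, h₃, Pi.smul_apply, smul_eq_mul]
  simp_rw [L1.norm_eq_integral_norm]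
  rw [← integral_zero E ℝ (μ := m)]
  refine tendsto_integral_of_dominated_convergence (fun x => v x)
    (fun k => (Lp.aestronglyMeasurable _).norm) (L1.integrable_coeFn v) (fun k => ?_) ?_
  · filter_upwards [hcoe, hu, (Lp.coeFn_nonneg v).2 hv] with x hx hux hvx
    simp only [Pi.zero_apply] at hvx
    have hmin : 0 ≤ min (v x) (k * u x) := le_min hvx (by positivity)
    rw [hx, norm_norm, Real.norm_of_nonneg (sub_nonneg.2 (min_le_left _ _))]
    linarith
  · filter_upwards [hcoe, hu] with x hx hux
    obtain ⟨N, hN⟩ := exists_nat_ge (v x / u x)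
    refine tendsto_const_nhds.congr' ?_
    filter_upwards [eventually_ge_atTop N] with k hk
    have hle : v x ≤ k * u x := (div_le_iff₀ hux).1 (hN.trans (by exact_mod_cast hk))
    rw [hx, min_eq_left hle, sub_self, norm_zero]

theorem tendsto_norm_pow_apply_of_nonneg {E : Type*} [MeasurableSpace E] {m : Measure E}
    {T : Lp ℝ 1 m →L[ℝ] Lp ℝ 1 m} (hTpos : ∀ u : Lp ℝ 1 m, 0 ≤ u → 0 ≤ T u)
    (hTcontr : ∀ u : Lp ℝ 1 m, ‖T u‖ ≤ ‖u‖) {u v : Lp ℝ 1 m} (hu_nonneg : 0 ≤ u)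
    (hu_pos : ∀ᵐ x ∂m, 0 < u x)
    (hu_lim : Tendsto (fun n : ℕ => ‖(T ^ n) u‖) atTop (nhds 0)) (hv : 0 ≤ v) :
    Tendsto (fun n : ℕ => ‖(T ^ n) v‖) atTop (nhds 0) := by
  have hpos : ∀ (n : ℕ) (w : Lp ℝ 1 m), 0 ≤ w → 0 ≤ (T ^ n) w := by
    intro n
    induction n with
    | zero => exact fun w hw => hw
    | succ n ih => exact fun w hw => by rw [pow_succ]; exact ih _ (hTpos w hw)
  have hcontr : ∀ (n : ℕ) (w : Lp ℝ 1 m), ‖(T ^ n) w‖ ≤ ‖w‖ := by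
    intro n
    induction n with
    | zero => exact fun w => le_rfl
    | succ n ih => exact fun w => by rw [pow_succ]; exact (ih _).trans (hTcontr w)
  have hbound : ∀ k n : ℕ, ‖(T ^ n) v‖ ≤ ‖v - v ⊓ (k : ℝ) • u‖ + k * ‖(T ^ n) u‖ := by
    intro k n
    have hku : 0 ≤ (k : ℝ) • u := by
      rw [Nat.cast_smul_eq_nsmul]
      exact nsmul_nonneg hu_nonneg k
    have hw : 0 ≤ (T ^ n) (v ⊓ (k : ℝ) • u) := hpos n _ (le_inf hv hku)
    have hle : (T ^ n) (v ⊓ (k : ℝ) • u) ≤ (T ^ n) ((k : ℝ) • u) := by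
      rw [← sub_nonneg, ← map_sub]
      exact hpos n _ (sub_nonneg.2 inf_le_right)
    have hnorm : ‖(T ^ n) (v ⊓ (k : ℝ) • u)‖ ≤ k * ‖(T ^ n) u‖ := by
      calc ‖(T ^ n) (v ⊓ (k : ℝ) • u)‖ ≤ ‖(T ^ n) ((k : ℝ) • u)‖ :=
            norm_le_norm_of_abs_le_abs (by rwa [abs_of_nonneg hw, abs_of_nonneg (hw.trans hle)])
        _ = k * ‖(T ^ n) u‖ := by rw [map_smul, norm_smul, Real.norm_natCast]
    calc ‖(T ^ n) v‖ = ‖(T ^ n) (v - v ⊓ (k : ℝ) • u) + (T ^ n) (v ⊓ (k : ℝ) • u)‖ := by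
          rw [← map_add, sub_add_cancel]
      _ ≤ _ := (norm_add_le _ _).trans (add_le_add (hcontr n _) hnorm)
  rw [Metric.tendsto_atTop]
  intro ε hε
  obtain ⟨k, hk⟩ := ((tendsto_norm_sub_inf_natCast_smul hu_pos hv).eventually_lt_const
    (half_pos hε)).exists
  have hlim : Tendsto (fun n : ℕ => (k : ℝ) * ‖(T ^ n) u‖) atTop (nhds 0) := by
    simpa using hu_lim.const_mul (k : ℝ)
  obtain ⟨N, hN⟩ := eventually_atTop.1 (hlim.eventually_lt_const (half_pos hε))
  refine ⟨N, fun n hn => ?_⟩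
  rw [dist_zero_right, norm_norm]
  linarith [hbound k n, hN n hn]

/-- Let `T` be a positive contraction on `L¹`. If there exists `u ∈ L¹` with
`u ≥ 0` a.e., `u > 0` a.e., and `‖Tⁿu‖ → 0`, then `‖Tⁿv‖ → 0` for every `v ∈ L¹`,
i.e. `T` is strongly stable. -/
theorem strongly_stable_of_positive_vanishing_vector
    {E : Type*} [MeasurableSpace E] (m : Measure E) [SigmaFinite m]
    (T : Lp ℝ 1 m →L[ℝ] Lp ℝ 1 m)
    (hTpos : ∀ u : Lp ℝ 1 m, 0 ≤ u → 0 ≤ T u)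
    (hTcontr : ∀ u : Lp ℝ 1 m, ‖T u‖ ≤ ‖u‖)
    (u : Lp ℝ 1 m) (hu_nonneg : 0 ≤ u) (hu_pos : ∀ᵐ x ∂m, 0 < u x)
    (hu_lim : Tendsto (fun n : ℕ => ‖(T ^ n) u‖) atTop (nhds 0)) :
    ∀ v : Lp ℝ 1 m, Tendsto (fun n : ℕ => ‖(T ^ n) v‖) atTop (nhds 0) := by
  intro v
  have hp := tendsto_norm_pow_apply_of_nonneg hTpos hTcontr hu_nonneg hu_pos hu_lim
    (posPart_nonneg v)
  have hn := tendsto_norm_pow_apply_of_nonneg hTpos hTcontr hu_nonneg hu_pos hu_lim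
    (negPart_nonneg v)
  have hle : ∀ n : ℕ, ‖(T ^ n) v‖ ≤ ‖(T ^ n) v⁺‖ + ‖(T ^ n) v⁻‖ := by
    intro n
    conv_lhs => rw [← posPart_sub_negPart v, map_sub]
    exact norm_sub_le _ _
  exact squeeze_zero (fun n => norm_nonneg _) hle (by simpa using hp.add hn)
end

section
/- Let T and K be positive contractions on L¹ such that Tu ≤ Ku m-a.e. for every u ∈ L¹ with u ≥ 0 m-a.e. If K is mean ergodic then T is mean ergodic. -/
open MeasureTheory Filter

open scoped Topology

/-- A bounded family in a real Hilbert space converges weakly along every ultrafilter. -/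
theorem InnerProductSpace.exists_forall_dual_tendsto_ultrafilter {ι H : Type*} [NormedAddCommGroup H]
    [InnerProductSpace ℝ H] [CompleteSpace H] (U : Ultrafilter ι) (f : ι → H) (C : ℝ)
    (hf : ∀ i, ‖f i‖ ≤ C) :
    ∃ y : H, ∀ φ : StrongDual ℝ H, Tendsto (fun i ↦ φ (f i)) U (𝓝 (φ y)) := by
  let F : ι → WeakDual ℝ H := fun i ↦ StrongDual.toWeakDual (InnerProductSpace.toDual ℝ H (f i))
  have hF : ∀ i, F i ∈ WeakDual.toStrongDual ⁻¹' Metric.closedBall (0 : StrongDual ℝ H) C := by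
    intro i
    simpa [F] using hf i
  obtain ⟨z, -, hz⟩ := (WeakDual.isCompact_closedBall (0 : StrongDual ℝ H) C).ultrafilter_le_nhds
    (U.map F) (le_principal_iff.2 (mem_map.2 (univ_mem' hF)))
  refine ⟨(InnerProductSpace.toDual ℝ H).symm (WeakDual.toStrongDual z), fun φ ↦ ?_⟩
  have key := ((WeakDual.eval_continuous ((InnerProductSpace.toDual ℝ H).symm φ)).tendsto z).comp
    (show Tendsto F U (𝓝 z) from hz)
  convert key using 2
  · simp [F, real_inner_comm, ← InnerProductSpace.toDual_symm_apply]
  · rw [← InnerProductSpace.toDual_symm_apply, real_inner_comm,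
      InnerProductSpace.toDual_symm_apply]
    rfl

/-- A point killed by every continuous functional vanishing on a subspace lies in the closure of that
subspace. -/
theorem Submodule.mem_topologicalClosure_of_forall_dual {X : Type*} [NormedAddCommGroup X]
    [NormedSpace ℝ X] (S : Submodule ℝ X) (x : X)
    (h : ∀ φ : StrongDual ℝ X, (∀ y ∈ S, φ y = 0) → φ x = 0) : x ∈ S.topologicalClosure := by
  have : IsClosed (S.topologicalClosure : Set X) := S.isClosed_topologicalClosure
  rw [← Submodule.Quotient.mk_eq_zero]
  refine SeparatingDual.eq_zero_of_forall_dual_eq_zero (R := ℝ) fun g ↦ ?_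
  refine h (g.comp S.topologicalClosure.mkQL) fun y hy ↦ ?_
  have : S.topologicalClosure.mkQL y = 0 :=
    (Submodule.Quotient.mk_eq_zero _).2 (S.le_topologicalClosure hy)
  simp [this]

/-- **Yosida's mean ergodic theorem**: if the Cesàro averages of a contraction at `u` converge weakly
along some filter finer than `atTop`, then they converge in norm. -/
theorem ContinuousLinearMap.tendsto_birkhoffAverage_of_forall_dual_tendsto {X : Type*}
    [NormedAddCommGroup X] [NormedSpace ℝ X] (T : X →L[ℝ] X) (hT : ‖T‖ ≤ 1) {l : Filter ℕ} [l.NeBot]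
    (hl : l ≤ atTop) (u w : X) (h : ∀ φ : StrongDual ℝ X,
      Tendsto (fun N ↦ φ (birkhoffAverage ℝ T _root_.id N u)) l (𝓝 (φ w))) :
    Tendsto (birkhoffAverage ℝ T _root_.id · u) atTop (𝓝 w) := by
  have hLip : LipschitzWith 1 T := T.lipschitz.weaken hT
  have hbdd (x : X) : Bornology.IsBounded (Set.range (_root_.id <| T^[·] x)) :=
    isBounded_iff_forall_norm_le.2 ⟨‖x‖, Set.forall_mem_range.2 fun n ↦ by
      have H : T^[n] 0 = 0 := iterate_map_zero (T : X →+ X) n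
      simpa [H] using (hLip.iterate n).dist_le_mul x 0⟩
  have hcomm (N : ℕ) (x : X) :
      birkhoffAverage ℝ T _root_.id N (T x) = T (birkhoffAverage ℝ T _root_.id N x) := by
    simp only [birkhoffAverage, birkhoffSum, map_smul, map_sum, _root_.id,
      ← Function.iterate_succ_apply, ← Function.iterate_succ_apply']
  have hw : T w = w := by
    refine (SeparatingDual.eq_iff_forall_dual_eq (R := ℝ)).2 fun φ ↦ ?_
    have h₁ := (h (φ.comp T)).sub (h φ)
    have h₂ := (φ.continuous.tendsto 0).comp
      ((tendsto_birkhoffAverage_apply_sub_birkhoffAverage ℝ (hbdd u)).mono_left hl)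
    rw [← sub_eq_zero, ← map_zero φ]
    refine tendsto_nhds_unique h₁ (h₂.congr fun N ↦ ?_)
    simp [hcomm]
  have hmem : u - w ∈ (LinearMap.range (T - 1 : X →L[ℝ] X).toLinearMap).topologicalClosure := by
    refine Submodule.mem_topologicalClosure_of_forall_dual _ _ fun φ hφ ↦ ?_
    have hφT (x : X) : φ (T x) = φ x := by
      simpa [sub_eq_zero] using hφ _ ⟨x, rfl⟩
    have hφn (n : ℕ) : φ (T^[n] u) = φ u := by
      induction n with
      | zero => rfl
      | succ n ih => rw [Function.iterate_succ_apply', hφT, ih]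
    have hconst : Tendsto (fun N ↦ φ (birkhoffAverage ℝ T _root_.id N u)) l (𝓝 (φ u)) := by
      refine tendsto_const_nhds.congr' (((eventually_ne_atTop 0).filter_mono hl).mono fun N hN ↦ ?_)
      have : (N : ℝ) ≠ 0 := by exact_mod_cast hN
      simp [birkhoffAverage, birkhoffSum, hφn, this]
    rw [map_sub, tendsto_nhds_unique hconst (h φ), sub_self]
  have hclosed : IsClosed {x | Tendsto (birkhoffAverage ℝ T _root_.id · x) atTop (𝓝 0)} :=
    isClosed_setOfPred_tendsto_birkhoffAverage ℝ hLip uniformContinuous_id continuous_const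
  have hzero : Tendsto (birkhoffAverage ℝ T _root_.id · (u - w)) atTop (𝓝 0) := by
    refine closure_minimal (Set.forall_mem_range.2 fun x ↦ ?_) hclosed hmem
    have H : ∀ n x y, T^[n] (x - y) = T^[n] x - T^[n] y := iterate_map_sub (T : X →+ X)
    simpa [birkhoffAverage, birkhoffSum, Finset.sum_sub_distrib, smul_sub, H]
      using tendsto_birkhoffAverage_apply_sub_birkhoffAverage ℝ (hbdd x)
  have hfix : Function.IsFixedPt T w := hw
  have H : ∀ n x y, T^[n] (x - y) = T^[n] x - T^[n] y := iterate_map_sub (T : X →+ X)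
  simpa [birkhoffAverage, birkhoffSum, Finset.sum_sub_distrib, smul_sub, H]
    using hzero.add (hfix.tendsto_birkhoffAverage ℝ _root_.id)

theorem MeasureTheory.Lp.smul_nonneg_of_nonneg {E : Type*} [MeasurableSpace E] {m : Measure E}
    {p : ENNReal} {c : ℝ} (hc : 0 ≤ c) {f : Lp ℝ p m} (hf : 0 ≤ f) : 0 ≤ c • f := by
  rw [← Lp.coeFn_nonneg] at hf ⊢
  filter_upwards [hf, Lp.coeFn_smul c f] with e h₁ h₂
  rw [h₂]
  exact mul_nonneg hc h₁

/-- A family in an order interval `[0, v]` of `L¹` converges weakly along every ultrafilter. The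
interval is the image of a bounded set of `L²` under multiplication by `√v`. -/
theorem MeasureTheory.Lp.exists_forall_dual_tendsto_ultrafilter {ι E : Type*} [MeasurableSpace E]
    {m : Measure E} (U : Ultrafilter ι) (x : ι → Lp ℝ 1 m) (v : Lp ℝ 1 m)
    (hx₀ : ∀ i, 0 ≤ x i) (hxv : ∀ i, x i ≤ v) :
    ∃ w : Lp ℝ 1 m, ∀ φ : StrongDual ℝ (Lp ℝ 1 m),
      Tendsto (fun i ↦ φ (x i)) U (𝓝 (φ w)) := by
  have hs : MemLp (fun e ↦ √(v e)) 2 m := by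
    rw [memLp_two_iff_integrable_sq (Real.continuous_sqrt.comp_aestronglyMeasurable
      (Lp.aestronglyMeasurable v))]
    refine (L1.integrable_coeFn v).pos_part.congr (Eventually.of_forall fun e ↦ ?_)
    rcases le_total 0 (v e) with h | h
    · simp [h]
    · simp [h, Real.sqrt_eq_zero_of_nonpos h]
  have hbd (i : ι) : ∀ᵐ e ∂m, 0 ≤ x i e ∧ x i e ≤ v e := by
    filter_upwards [(Lp.coeFn_nonneg _).2 (hx₀ i), (Lp.coeFn_le _ _).2 (hxv i)] with e h₁ h₂
    exact ⟨h₁, h₂⟩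
  have hle (i : ι) : ∀ᵐ e ∂m, ‖x i e / √(v e)‖ ≤ ‖√(v e)‖ := by
    filter_upwards [hbd i] with e ⟨h₁, h₂⟩
    rw [Real.norm_of_nonneg (by positivity), Real.norm_of_nonneg (by positivity)]
    refine div_le_of_le_mul₀ (by positivity) (by positivity) ?_
    rwa [Real.mul_self_sqrt (h₁.trans h₂)]
  have hq (i : ι) : MemLp (fun e ↦ x i e / √(v e)) 2 m :=
    hs.of_le ((Lp.aestronglyMeasurable _).div₀ hs.aestronglyMeasurable) (hle i)
  let J : Lp ℝ 2 m →L[ℝ] Lp ℝ 1 m := (ContinuousLinearMap.mul ℝ ℝ).holderL m 2 2 1 hs.toLp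
  obtain ⟨y, hy⟩ := InnerProductSpace.exists_forall_dual_tendsto_ultrafilter U (fun i ↦ (hq i).toLp) ‖hs.toLp‖
    fun i ↦ by
      refine Lp.norm_le_norm_of_ae_le ?_
      filter_upwards [hle i, (hq i).coeFn_toLp, hs.coeFn_toLp] with e h₁ h₂ h₃
      rwa [h₂, h₃]
  refine ⟨J y, fun φ ↦ (hy (φ.comp J)).congr fun i ↦ congrArg φ (Lp.ext ?_)⟩
  filter_upwards [(ContinuousLinearMap.mul ℝ ℝ).coeFn_holder (r := 1) hs.toLp (hq i).toLp, hbd i,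
    (hq i).coeFn_toLp, hs.coeFn_toLp] with e h₁ ⟨h₂, h₃⟩ h₄ h₅
  change (ContinuousLinearMap.mul ℝ ℝ).holder 1 hs.toLp (hq i).toLp e = x i e
  rw [h₁, h₄, h₅, ContinuousLinearMap.mul_apply']
  rcases (h₂.trans h₃).eq_or_lt with h | h
  · rw [← h] at h₃ ⊢
    simp [le_antisymm h₃ h₂]
  · have := Real.sqrt_pos.2 h
    field_simp

/-- Let `T` and `K` be positive contractions on `L¹` with `T` dominated by
`K` on the positive cone.  If `K` is mean ergodic then `T` is mean ergodic. -/
theorem mean_ergodic_of_dominated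
    {E : Type*} [MeasurableSpace E] (m : Measure E) [SigmaFinite m]
    (T K : Lp ℝ 1 m →L[ℝ] Lp ℝ 1 m)
    (hTpos : ∀ u : Lp ℝ 1 m, 0 ≤ u → 0 ≤ T u)
    (hTcontr : ∀ u : Lp ℝ 1 m, ‖T u‖ ≤ ‖u‖)
    (hKpos : ∀ u : Lp ℝ 1 m, 0 ≤ u → 0 ≤ K u)
    (hKcontr : ∀ u : Lp ℝ 1 m, ‖K u‖ ≤ ‖u‖)
    (hdom : ∀ u : Lp ℝ 1 m, 0 ≤ u → T u ≤ K u)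
    (hKme : ∀ u : Lp ℝ 1 m, ∃ v : Lp ℝ 1 m,
      Tendsto (fun N : ℕ => (N : ℝ)⁻¹ • ∑ n ∈ Finset.range N, (K ^ n) u) atTop (nhds v)) :
    ∀ u : Lp ℝ 1 m, ∃ v : Lp ℝ 1 m,
      Tendsto (fun N : ℕ => (N : ℝ)⁻¹ • ∑ n ∈ Finset.range N, (T ^ n) u) atTop (nhds v) := by
  have hT : ‖T‖ ≤ 1 := T.opNorm_le_bound zero_le_one fun u ↦ by simpa using hTcontr u
  have hpow₀ (u : Lp ℝ 1 m) (hu : 0 ≤ u) (n : ℕ) : 0 ≤ (T ^ n) u := by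
    induction n with
    | zero => simpa
    | succ n ih =>
      rw [pow_succ', mul_apply_eq_comp]
      exact hTpos _ ih
  have hpow (u : Lp ℝ 1 m) (hu : 0 ≤ u) (n : ℕ) : (T ^ n) u ≤ (K ^ n) u := by
    induction n with
    | zero => simp
    | succ n ih =>
      rw [pow_succ', pow_succ', mul_apply_eq_comp, mul_apply_eq_comp]
      refine (hdom _ (hpow₀ u hu n)).trans ?_
      rw [← sub_nonneg, ← map_sub]
      exact hKpos _ (sub_nonneg.2 ih)
  have hnonneg (u : Lp ℝ 1 m) (hu : 0 ≤ u) : ∃ w : Lp ℝ 1 m,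
      Tendsto (fun N : ℕ ↦ (N : ℝ)⁻¹ • ∑ n ∈ Finset.range N, (T ^ n) u) atTop (nhds w) := by
    obtain ⟨v, hv⟩ := hKme u
    set a : ℕ → Lp ℝ 1 m := fun N ↦ (N : ℝ)⁻¹ • ∑ n ∈ Finset.range N, (T ^ n) u with ha
    set b : ℕ → Lp ℝ 1 m := fun N ↦ (N : ℝ)⁻¹ • ∑ n ∈ Finset.range N, (K ^ n) u
    have ha₀ (N : ℕ) : 0 ≤ a N :=
      Lp.smul_nonneg_of_nonneg (by positivity) (Finset.sum_nonneg fun n _ ↦ hpow₀ u hu n)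
    have hab (N : ℕ) : a N ≤ b N := by
      rw [← sub_nonneg, ← smul_sub]
      exact Lp.smul_nonneg_of_nonneg (by positivity)
        (sub_nonneg.2 (Finset.sum_le_sum fun n _ ↦ hpow u hu n))
    have hv₀ : 0 ≤ v := ge_of_tendsto' hv fun N ↦ (ha₀ N).trans (hab N)
    obtain ⟨w, hw⟩ := Lp.exists_forall_dual_tendsto_ultrafilter (hyperfilter ℕ)
      (fun N ↦ a N ⊓ v) v (fun N ↦ le_inf (ha₀ N) hv₀) fun N ↦ inf_le_right
    have herr : Tendsto (fun N ↦ a N - a N ⊓ v) atTop (𝓝 0) := by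
      refine squeeze_zero_norm (fun N ↦ ?_) (tendsto_iff_norm_sub_tendsto_zero.1 hv)
      refine norm_le_norm_of_abs_le_abs ?_
      rw [abs_of_nonneg (sub_nonneg.2 inf_le_left), sub_inf, sub_self]
      exact sup_le (abs_nonneg _) ((sub_le_sub_right (hab N) v).trans (le_abs_self _))
    have hle : (hyperfilter ℕ : Filter ℕ) ≤ atTop := Nat.hyperfilter_le_atTop
    have hbirk (N : ℕ) : birkhoffAverage ℝ T id N u = a N := by
      simp [birkhoffAverage, birkhoffSum, ha]
    refine ⟨w, ?_⟩
    have := T.tendsto_birkhoffAverage_of_forall_dual_tendsto hT hle u w fun φ ↦ by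
      simp only [hbirk]
      have h₁ := (hw φ).add (((φ.continuous.tendsto 0).comp herr).mono_left hle)
      simpa using h₁
    simpa only [hbirk] using this
  intro u
  obtain ⟨w₁, h₁⟩ := hnonneg u⁺ (posPart_nonneg u)
  obtain ⟨w₂, h₂⟩ := hnonneg u⁻ (negPart_nonneg u)
  refine ⟨w₁ - w₂, (h₁.sub h₂).congr fun N ↦ ?_⟩
  rw [← smul_sub, ← Finset.sum_sub_distrib]
  simp_rw [← map_sub, posPart_sub_negPart]
end

section
/- For every λ > 0 the operator T_λ u := B(R(λ)u) is a well-defined positive linear map of L¹ into itself satisfying ‖T_λu‖ + λ‖R(λ)u‖ = ‖u‖ for every u ∈ L¹ with u ≥ 0 m-a.e.; consequently ‖T_λu‖ ≤ ‖u‖ for all u ∈ L¹, and if u ∈ L¹ satisfies T_λu = u then u = 0. -/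
open MeasureTheory Filter

section L1

variable {E : Type*} [MeasurableSpace E] {m : Measure E}

lemma L1_norm_eq_integral_of_nonneg {f : Lp ℝ 1 m} (hf : 0 ≤ f) : ‖f‖ = ∫ x, f x ∂m := by
  rw [L1.norm_eq_integral_norm]
  refine integral_congr_ae ?_
  filter_upwards [(Lp.coeFn_nonneg f).2 hf] with x hx
  exact Real.norm_of_nonneg hx

lemma isOrderedModule_L1 : IsOrderedModule ℝ (Lp ℝ 1 m) := by
  refine .of_smul_nonneg fun c hc f hf => ?_
  rw [← Lp.coeFn_nonneg] at hf ⊢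
  filter_upwards [hf, Lp.coeFn_smul c f] with x hx h
  rw [h]
  exact mul_nonneg hc hx

/-- A positive additive map of `L¹` is dominated in modulus by its value at the modulus. -/
lemma abs_map_le_map_abs {T : Lp ℝ 1 m → Lp ℝ 1 m} (hadd : ∀ u v, T (u + v) = T u + T v)
    (hpos : ∀ u, 0 ≤ u → 0 ≤ T u) (u : Lp ℝ 1 m) : |T u| ≤ T |u| := by
  have hsub (v w : Lp ℝ 1 m) : T (v - w) = T v - T w := by
    rw [eq_sub_iff_add_eq, ← hadd, sub_add_cancel]
  have hzero : T 0 = 0 := by simpa using hsub 0 0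
  have hmono {v w : Lp ℝ 1 m} (h : v ≤ w) : T v ≤ T w := by
    rw [← sub_nonneg, ← hsub]
    exact hpos _ (sub_nonneg.2 h)
  refine abs_le'.2 ⟨hmono (le_abs_self u), ?_⟩
  have hneg : -T u = T (-u) := by rw [← zero_sub u, hsub, hzero, zero_sub]
  rw [hneg]
  exact hmono (neg_le_abs u)

end L1

/-- The Laplace transform of a bounded continuous function converges absolutely. -/
lemma integrableOn_exp_neg_smul {X : Type*} [NormedAddCommGroup X] [NormedSpace ℝ X]
    {f : ℝ → X} {C l : ℝ} (hl : 0 < l) (hf : ContinuousOn f (Set.Ici 0))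
    (hC : ∀ t, 0 ≤ t → ‖f t‖ ≤ C) :
    IntegrableOn (fun t => Real.exp (-l * t) • f t) (Set.Ioi 0) := by
  refine Integrable.mono' ((exp_neg_integrableOn_Ioi 0 hl).mul_const C) ?_ ?_
  · refine ContinuousOn.aestronglyMeasurable ?_ measurableSet_Ioi
    exact (by fun_prop : Continuous fun t : ℝ => Real.exp (-l * t)).continuousOn.smul
      (hf.mono Set.Ioi_subset_Ici_self)
  · filter_upwards [ae_restrict_mem measurableSet_Ioi] with t ht
    rw [norm_smul, Real.norm_of_nonneg (Real.exp_pos _).le]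
    exact mul_le_mul_of_nonneg_left (hC t (le_of_lt ht)) (Real.exp_pos _).le

/-- In the Kato–Voigt perturbation setting (`A` the generator of a
substochastic semigroup with resolvent `R(λ)`, `B` positive on `D(A)` with
`∫ (Au + Bu) dm = 0` for `0 ≤ u ∈ D(A)`), for every `λ > 0` the operator
`T_λ u = B(R(λ)u)` is a well-defined positive linear map of `L¹` into itself with
`‖T_λ u‖ + λ‖R(λ)u‖ = ‖u‖` for `u ≥ 0`; consequently `‖T_λ u‖ ≤ ‖u‖` for all `u`, and
`T_λ u = u` implies `u = 0`. -/
theorem BRlambda_positive_contraction_no_fixed_points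
    {E : Type*} [MeasurableSpace E] (m : Measure E) [SigmaFinite m]
    (S : ℝ → Lp ℝ 1 m →L[ℝ] Lp ℝ 1 m)
    (hS0 : S 0 = 1)
    (hSsemi : ∀ s t : ℝ, 0 ≤ s → 0 ≤ t → S (s + t) = (S s).comp (S t))
    (hSpos : ∀ t : ℝ, 0 ≤ t → ∀ u : Lp ℝ 1 m, 0 ≤ u → 0 ≤ S t u)
    (hScontr : ∀ t : ℝ, 0 ≤ t → ∀ u : Lp ℝ 1 m, ‖S t u‖ ≤ ‖u‖)
    (hScont : ∀ u : Lp ℝ 1 m, ContinuousOn (fun t => S t u) (Set.Ici 0))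
    (domA : Set (Lp ℝ 1 m)) (A : Lp ℝ 1 m → Lp ℝ 1 m)
    (hdomA : domA = {u | ∃ v : Lp ℝ 1 m,
      Tendsto (fun t : ℝ => t⁻¹ • (S t u - u)) (nhdsWithin 0 (Set.Ioi 0)) (nhds v)})
    (hA : ∀ u ∈ domA,
      Tendsto (fun t : ℝ => t⁻¹ • (S t u - u)) (nhdsWithin 0 (Set.Ioi 0)) (nhds (A u)))
    (R : ℝ → Lp ℝ 1 m → Lp ℝ 1 m)
    (hR : ∀ l : ℝ, 0 < l → ∀ u : Lp ℝ 1 m,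
      R l u = ∫ t in Set.Ioi (0 : ℝ), Real.exp (-l * t) • S t u)
    (hRmem : ∀ l : ℝ, 0 < l → ∀ u : Lp ℝ 1 m, R l u ∈ domA)
    (hRA : ∀ l : ℝ, 0 < l → ∀ u : Lp ℝ 1 m, A (R l u) = l • R l u - u)
    (B : Lp ℝ 1 m → Lp ℝ 1 m)
    (hBadd : ∀ u ∈ domA, ∀ v ∈ domA, B (u + v) = B u + B v)
    (hBsmul : ∀ (c : ℝ), ∀ u ∈ domA, B (c • u) = c • B u)
    (hBpos : ∀ u ∈ domA, 0 ≤ u → 0 ≤ B u)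
    (hABint : ∀ u ∈ domA, 0 ≤ u → ∫ x, (A u x + B u x) ∂m = 0) :
    ∀ l : ℝ, 0 < l →
      (∀ u v : Lp ℝ 1 m, B (R l (u + v)) = B (R l u) + B (R l v)) ∧
      (∀ (c : ℝ) (u : Lp ℝ 1 m), B (R l (c • u)) = c • B (R l u)) ∧
      (∀ u : Lp ℝ 1 m, 0 ≤ u → 0 ≤ B (R l u)) ∧
      (∀ u : Lp ℝ 1 m, 0 ≤ u → ‖B (R l u)‖ + l * ‖R l u‖ = ‖u‖) ∧
      (∀ u : Lp ℝ 1 m, ‖B (R l u)‖ ≤ ‖u‖) ∧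
      (∀ u : Lp ℝ 1 m, B (R l u) = u → u = 0) := by
  intro l hl
  have hRint (u : Lp ℝ 1 m) :
      IntegrableOn (fun t => Real.exp (-l * t) • S t u) (Set.Ioi 0) :=
    integrableOn_exp_neg_smul hl (hScont u) (fun t ht => hScontr t ht u)
  have hRadd (u v : Lp ℝ 1 m) : R l (u + v) = R l u + R l v := by
    simp only [hR l hl, map_add, smul_add]
    exact integral_add (hRint u) (hRint v)
  have hRsmul (c : ℝ) (u : Lp ℝ 1 m) : R l (c • u) = c • R l u := by
    simp only [hR l hl, map_smul, smul_comm _ c]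
    exact integral_smul c _
  have hRpos (u : Lp ℝ 1 m) (hu : 0 ≤ u) : 0 ≤ R l u := by
    have := isOrderedModule_L1 (m := m)
    rw [hR l hl]
    refine integral_nonneg_of_ae ?_
    filter_upwards [ae_restrict_mem measurableSet_Ioi] with t ht
    exact smul_nonneg (Real.exp_pos _).le (hSpos t (le_of_lt ht) u hu)
  have hadd (u v : Lp ℝ 1 m) : B (R l (u + v)) = B (R l u) + B (R l v) := by
    rw [hRadd, hBadd _ (hRmem l hl u) _ (hRmem l hl v)]
  have hpos (u : Lp ℝ 1 m) (hu : 0 ≤ u) : 0 ≤ B (R l u) :=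
    hBpos _ (hRmem l hl u) (hRpos u hu)
  have hnorm (u : Lp ℝ 1 m) (hu : 0 ≤ u) : ‖B (R l u)‖ + l * ‖R l u‖ = ‖u‖ := by
    have h := hABint _ (hRmem l hl u) (hRpos u hu)
    have hAint : ∫ x, A (R l u) x ∂m = l * ∫ x, R l u x ∂m - ∫ x, u x ∂m := by
      rw [hRA l hl, ← integral_const_mul, ← integral_sub
        ((L1.integrable_coeFn (R l u)).const_mul l) (L1.integrable_coeFn u)]
      refine integral_congr_ae ?_
      filter_upwards [Lp.coeFn_sub (l • R l u) u, Lp.coeFn_smul l (R l u)] with x h₁ h₂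
      rw [h₁, Pi.sub_apply, h₂, Pi.smul_apply, smul_eq_mul]
    rw [integral_add (L1.integrable_coeFn _) (L1.integrable_coeFn _), hAint] at h
    rw [L1_norm_eq_integral_of_nonneg hu, L1_norm_eq_integral_of_nonneg (hRpos u hu),
      L1_norm_eq_integral_of_nonneg (hpos u hu)]
    linarith
  have habs (u : Lp ℝ 1 m) : ‖B (R l u)‖ ≤ ‖B (R l |u|)‖ :=
    norm_le_norm_of_abs_le_abs
      ((abs_map_le_map_abs (T := fun w => B (R l w)) hadd hpos u).trans (le_abs_self _))
  refine ⟨hadd, fun c u => by rw [hRsmul, hBsmul c _ (hRmem l hl u)], hpos, hnorm, ?_, ?_⟩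
  · intro u
    have h := hnorm |u| (abs_nonneg u)
    rw [norm_abs_eq_norm] at h
    have h' := mul_nonneg hl.le (norm_nonneg (R l |u|))
    linarith [habs u]
  · intro u hu
    have h := hnorm |u| (abs_nonneg u)
    have hle := habs u
    rw [hu] at hle
    rw [norm_abs_eq_norm] at h
    have hRzero : R l |u| = 0 := by
      rw [← norm_le_zero_iff]
      exact nonpos_of_mul_nonpos_right (by linarith) hl
    have hBzero : B 0 = 0 := by
      simpa using hBsmul 0 _ (hRmem l hl u)
    rw [hRzero, hBzero, norm_zero] at hle
    exact norm_le_zero_iff.1 hle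
end

section
/- For each fixed λ > 0 the following are equivalent: (i) the positive contraction T_λ is mean ergodic; (ii) there exists u ∈ L¹ with u ≥ 0 m-a.e., u > 0 m-a.e., and ‖T_λⁿu‖ → 0 as n → ∞; (iii) ‖T_λⁿu‖ → 0 as n → ∞ for every u ∈ L¹. (Each condition characterizes stochasticity of the minimal Kato–Voigt semigroup generated by an extension of A + B.) -/
open MeasureTheory Filter

namespace MeasureTheory.L1

variable {E : Type*} [MeasurableSpace E] {m : Measure E}

instance instIsOrderedModule : IsOrderedModule ℝ (Lp ℝ 1 m) :=
  IsOrderedModule.of_smul_nonneg fun c hc u hu => by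
    rw [← Lp.coeFn_nonneg] at hu ⊢
    filter_upwards [hu, Lp.coeFn_smul c u] with x hx hcx
    rw [hcx]
    exact mul_nonneg hc hx

theorem norm_eq_integral_of_nonneg {u : Lp ℝ 1 m} (hu : 0 ≤ u) : ‖u‖ = ∫ x, u x ∂m := by
  rw [L1.norm_eq_integral_norm]
  refine integral_congr_ae ?_
  filter_upwards [(Lp.coeFn_nonneg u).2 hu] with x hx
  exact Real.norm_of_nonneg hx

theorem norm_add_of_nonneg {u v : Lp ℝ 1 m} (hu : 0 ≤ u) (hv : 0 ≤ v) :
    ‖u + v‖ = ‖u‖ + ‖v‖ := by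
  rw [norm_eq_integral_of_nonneg hu, norm_eq_integral_of_nonneg hv,
    norm_eq_integral_of_nonneg (add_nonneg hu hv)]
  exact (integral_congr_ae (Lp.coeFn_add u v)).trans
    (MeasureTheory.integral_add (L1.integrable_coeFn u) (L1.integrable_coeFn v))

theorem norm_sum_of_nonneg {ι : Type*} (s : Finset ι) {u : ι → Lp ℝ 1 m} (hu : ∀ i, 0 ≤ u i) :
    ‖∑ i ∈ s, u i‖ = ∑ i ∈ s, ‖u i‖ := by
  classical
  induction s using Finset.induction_on with
  | empty => simp
  | insert i s hi ih =>
    rw [Finset.sum_insert hi, Finset.sum_insert hi,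
      norm_add_of_nonneg (hu i) (Finset.sum_nonneg fun j _ => hu j), ih]

theorem exists_pos (m : Measure E) [SigmaFinite m] :
    ∃ u : Lp ℝ 1 m, 0 ≤ u ∧ ∀ᵐ x ∂m, 0 < u x := by
  obtain ⟨g, hg, hgm, hgi⟩ := exists_pos_lintegral_lt_of_sigmaFinite m one_ne_zero
  have hint : Integrable (fun x => (g x : ℝ)) m := by
    refine ⟨hgm.coe_nnreal_real.aestronglyMeasurable, ?_⟩
    simpa [HasFiniteIntegral] using hgi.trans ENNReal.one_lt_top
  have hpos : ∀ᵐ x ∂m, 0 < hint.toL1 _ x := by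
    filter_upwards [hint.coeFn_toL1] with x hx
    rw [hx]
    exact_mod_cast hg x
  exact ⟨hint.toL1 _, (Lp.coeFn_nonneg _).1 (hpos.mono fun x hx => hx.le), hpos⟩

/-- Truncations of a nonnegative function by multiples of a strictly positive one converge to it. -/
theorem tendsto_inf_nsmul {u v : Lp ℝ 1 m} (hu : ∀ᵐ x ∂m, 0 < u x) (hv : 0 ≤ v) :
    Tendsto (fun k : ℕ => ‖v - v ⊓ (k : ℝ) • u‖) atTop (nhds 0) := by
  have hcoe (k : ℕ) : (fun x => v x - v x ⊓ (k * u x)) =ᵐ[m] ⇑(v - v ⊓ (k : ℝ) • u) := by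
    filter_upwards [Lp.coeFn_sub v (v ⊓ (k : ℝ) • u), Lp.coeFn_inf v ((k : ℝ) • u),
      Lp.coeFn_smul (k : ℝ) u] with x h1 h2 h3
    rw [h1, Pi.sub_apply, h2, Pi.inf_apply, h3, Pi.smul_apply, smul_eq_mul]
  have hnorm (k : ℕ) : ‖v - v ⊓ (k : ℝ) • u‖ = ∫ x, ‖v x - v x ⊓ (k * u x)‖ ∂m := by
    rw [L1.norm_eq_integral_norm]
    exact integral_congr_ae ((hcoe k).symm.fun_comp _)
  simp_rw [hnorm]
  have hzero : ∫ _, (0 : ℝ) ∂m = 0 := by simp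
  rw [← hzero]
  refine tendsto_integral_of_dominated_convergence (fun x => ‖v x‖) (fun k => ?_)
    (L1.integrable_coeFn v).norm (fun k => ?_) ?_
  · exact ((Lp.aestronglyMeasurable _).congr (hcoe k).symm).norm
  · filter_upwards [hu, (Lp.coeFn_nonneg v).2 hv] with x hux hvx
    have hvx : 0 ≤ v x := hvx
    have h0 : 0 ≤ v x ⊓ (k * u x) := le_inf hvx (by positivity)
    rw [norm_norm, Real.norm_of_nonneg (sub_nonneg.2 inf_le_left), Real.norm_of_nonneg hvx]
    linarith
  · filter_upwards [hu] with x hux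
    obtain ⟨K, hK⟩ := exists_nat_ge (v x / u x)
    refine tendsto_const_nhds.congr' ?_
    filter_upwards [eventually_ge_atTop K] with k hk
    have hle : v x ≤ k * u x := by
      rw [← div_le_iff₀ hux]
      exact hK.trans (by exact_mod_cast hk)
    simp [inf_eq_left.2 hle]

section PositiveContraction

variable {P : Lp ℝ 1 m →ₗ[ℝ] Lp ℝ 1 m}

theorem iterate_nonneg (hP : ∀ u, 0 ≤ u → 0 ≤ P u) {u : Lp ℝ 1 m} (hu : 0 ≤ u) (n : ℕ) :
    0 ≤ P^[n] u := by
  induction n with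
  | zero => exact hu
  | succ n ih =>
    rw [Function.iterate_succ_apply']
    exact hP _ ih

theorem antitone_norm_iterate (hP : ∀ u, ‖P u‖ ≤ ‖u‖) (u : Lp ℝ 1 m) :
    Antitone fun n => ‖P^[n] u‖ :=
  antitone_nat_of_succ_le fun n => by
    rw [Function.iterate_succ_apply']
    exact hP _

theorem tendsto_norm_iterate_of_nonneg
    (h : ∀ u, 0 ≤ u → Tendsto (fun n => ‖P^[n] u‖) atTop (nhds 0)) (u : Lp ℝ 1 m) :
    Tendsto (fun n => ‖P^[n] u‖) atTop (nhds 0) := by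
  have hadd := (h u⁺ (posPart_nonneg u)).add (h u⁻ (negPart_nonneg u))
  rw [add_zero] at hadd
  refine squeeze_zero (fun _ => norm_nonneg _) (fun n => ?_) hadd
  calc ‖P^[n] u‖ = ‖P^[n] u⁺ - P^[n] u⁻‖ := by
        rw [← iterate_map_sub, posPart_sub_negPart]
    _ ≤ _ := norm_sub_le _ _

theorem norm_iterate_le_add_smul (hpos : ∀ u, 0 ≤ u → 0 ≤ P u) (hcontr : ∀ u, ‖P u‖ ≤ ‖u‖)
    {u v : Lp ℝ 1 m} (hu : 0 ≤ u) (hv : 0 ≤ v) {c : ℝ} (hc : 0 ≤ c) (n : ℕ) :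
    ‖P^[n] v‖ ≤ ‖v - v ⊓ c • u‖ + c * ‖P^[n] u‖ := by
  have hinf : 0 ≤ v ⊓ c • u := le_inf hv (smul_nonneg hc hu)
  have hle : P^[n] (v ⊓ c • u) ≤ c • P^[n] u := by
    have h := iterate_nonneg hpos (sub_nonneg.2 (inf_le_right : v ⊓ c • u ≤ _)) n
    rwa [iterate_map_sub, ← Module.End.coe_pow, map_smul, sub_nonneg, Module.End.coe_pow] at h
  have hnorm : ‖P^[n] (v ⊓ c • u)‖ ≤ c * ‖P^[n] u‖ := by
    have h := norm_le_norm_of_abs_le_abs (abs_le_abs_of_nonneg (iterate_nonneg hpos hinf n) hle)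
    rwa [norm_smul, Real.norm_of_nonneg hc] at h
  calc ‖P^[n] v‖ = ‖P^[n] (v - v ⊓ c • u) + P^[n] (v ⊓ c • u)‖ := by
        rw [← iterate_map_add, sub_add_cancel]
    _ ≤ ‖P^[n] (v - v ⊓ c • u)‖ + ‖P^[n] (v ⊓ c • u)‖ := norm_add_le _ _
    _ ≤ _ := add_le_add (antitone_norm_iterate hcontr _ n.zero_le) hnorm

/-- If the iterates of a positive contraction vanish at one strictly positive function, they vanish
everywhere. -/
theorem tendsto_norm_iterate_of_pos (hpos : ∀ u, 0 ≤ u → 0 ≤ P u) (hcontr : ∀ u, ‖P u‖ ≤ ‖u‖)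
    {u : Lp ℝ 1 m} (hu : ∀ᵐ x ∂m, 0 < u x)
    (hlim : Tendsto (fun n => ‖P^[n] u‖) atTop (nhds 0)) (w : Lp ℝ 1 m) :
    Tendsto (fun n => ‖P^[n] w‖) atTop (nhds 0) := by
  have hu0 : 0 ≤ u := (Lp.coeFn_nonneg _).1 (hu.mono fun x hx => hx.le)
  refine tendsto_norm_iterate_of_nonneg (fun v hv => ?_) w
  refine tendsto_order.2 ⟨fun a ha => .of_forall fun n => ha.trans_le (norm_nonneg _),
    fun ε hε => ?_⟩
  obtain ⟨k, hk⟩ := ((tendsto_inf_nsmul hu hv).eventually_lt_const (half_pos hε)).exists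
  have hku := hlim.const_mul (k : ℝ)
  rw [mul_zero] at hku
  filter_upwards [hku.eventually_lt_const (half_pos hε)] with n hn
  exact (norm_iterate_le_add_smul hpos hcontr hu0 hv k.cast_nonneg n).trans_lt
    ((add_lt_add hk hn).trans_eq (add_halves ε))

/-- The limit of the Cesàro averages of a contraction is a fixed point. -/
theorem map_eq_of_tendsto_cesaro (hcontr : ∀ u, ‖P u‖ ≤ ‖u‖) {u v : Lp ℝ 1 m}
    (h : Tendsto (fun N : ℕ => (N : ℝ)⁻¹ • ∑ n ∈ Finset.range N, P^[n] u) atTop (nhds v)) :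
    P v = v := by
  have hcont : Continuous P :=
    AddMonoidHomClass.continuous_of_bound P 1 fun x => by simpa using hcontr x
  have hsub := ((hcont.tendsto v).comp h).sub h
  have hzero : Tendsto (fun N : ℕ => (N : ℝ)⁻¹ • (P^[N] u - u)) atTop (nhds 0) := by
    have hlim : Tendsto (fun N : ℕ => (N : ℝ)⁻¹ * (‖u‖ + ‖u‖)) atTop (nhds 0) := by
      simpa using (tendsto_inv_atTop_nhds_zero_nat (𝕜 := ℝ)).mul_const (‖u‖ + ‖u‖)
    refine squeeze_zero_norm (fun N => ?_) hlim
    rw [norm_smul, norm_inv, Real.norm_natCast]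
    gcongr
    exact (norm_sub_le _ _).trans
      (add_le_add_left (antitone_norm_iterate hcontr u N.zero_le) _)
  refine sub_eq_zero.1 (tendsto_nhds_unique (hsub.congr fun N => ?_) hzero)
  simp only [Function.comp_apply, map_smul, map_sum, ← smul_sub, ← Finset.sum_sub_distrib,
    ← Function.iterate_succ_apply' P]
  rw [Finset.sum_range_sub (fun n => P^[n] u)]
  rfl

/-- The iterates of a mean ergodic positive contraction without nonzero positive fixed points
vanish. -/
theorem tendsto_norm_iterate_of_cesaro (hpos : ∀ u, 0 ≤ u → 0 ≤ P u)
    (hcontr : ∀ u, ‖P u‖ ≤ ‖u‖) (hfix : ∀ v, 0 ≤ v → P v = v → v = 0)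
    (h : ∀ u, ∃ v,
      Tendsto (fun N : ℕ => (N : ℝ)⁻¹ • ∑ n ∈ Finset.range N, P^[n] u) atTop (nhds v))
    (w : Lp ℝ 1 m) : Tendsto (fun n => ‖P^[n] w‖) atTop (nhds 0) := by
  refine tendsto_norm_iterate_of_nonneg (fun u hu => ?_) w
  obtain ⟨v, hv⟩ := h u
  have hv0 : 0 ≤ v := ge_of_tendsto' hv fun N => smul_nonneg (by positivity)
    (Finset.sum_nonneg fun n _ => iterate_nonneg hpos hu n)
  obtain rfl := hfix v hv0 (map_eq_of_tendsto_cesaro hcontr hv)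
  refine squeeze_zero' (.of_forall fun _ => norm_nonneg _) ?_ (norm_zero (E := Lp ℝ 1 m) ▸ hv.norm)
  filter_upwards [eventually_gt_atTop 0] with N hN
  have hN : (0 : ℝ) < N := by exact_mod_cast hN
  rw [norm_smul, norm_inv, Real.norm_natCast, norm_sum_of_nonneg _ (iterate_nonneg hpos hu),
    le_inv_mul_iff₀ hN]
  simpa using Finset.card_nsmul_le_sum (Finset.range N) (fun n => ‖P^[n] u‖) ‖P^[N] u‖
    fun n hn => antitone_norm_iterate hcontr u (Finset.mem_range.1 hn).le

end PositiveContraction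

/-- The Laplace transform of a bounded continuous orbit converges absolutely. -/
theorem integrableOn_exp_smul {X : Type*} [NormedAddCommGroup X] [NormedSpace ℝ X] {f : ℝ → X}
    (hf : ContinuousOn f (Set.Ici 0)) {C : ℝ} (hC : ∀ t, 0 ≤ t → ‖f t‖ ≤ C) {l : ℝ} (hl : 0 < l) :
    IntegrableOn (fun t => Real.exp (-l * t) • f t) (Set.Ioi 0) := by
  have hcont : ContinuousOn (fun t => Real.exp (-l * t) • f t) (Set.Ioi 0) :=
    ContinuousOn.smul (by fun_prop) (hf.mono Set.Ioi_subset_Ici_self)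
  refine ((exp_neg_integrableOn_Ioi 0 hl).mul_const C).mono'
    (hcont.aestronglyMeasurable measurableSet_Ioi) ?_
  filter_upwards [ae_restrict_mem measurableSet_Ioi] with t ht
  rw [norm_smul, Real.norm_of_nonneg (Real.exp_pos _).le]
  exact mul_le_mul_of_nonneg_left (hC t (Set.mem_Ioi.1 ht).le) (Real.exp_pos _).le

end MeasureTheory.L1

/-- In the Kato–Voigt perturbation setting, for each fixed `λ > 0` the
following are equivalent: (i) `T_λ` is mean ergodic; (ii) there is a strictly positive
`u ∈ L¹` with `‖T_λⁿ u‖ → 0`; (iii) `‖T_λⁿ u‖ → 0` for every `u ∈ L¹`.  (Each condition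
characterizes stochasticity of the minimal Kato–Voigt semigroup.) -/
theorem mean_ergodic_iff_iterates_vanish
    {E : Type*} [MeasurableSpace E] (m : Measure E) [SigmaFinite m]
    (S : ℝ → Lp ℝ 1 m →L[ℝ] Lp ℝ 1 m)
    (hS0 : S 0 = 1)
    (hSsemi : ∀ s t : ℝ, 0 ≤ s → 0 ≤ t → S (s + t) = (S s).comp (S t))
    (hSpos : ∀ t : ℝ, 0 ≤ t → ∀ u : Lp ℝ 1 m, 0 ≤ u → 0 ≤ S t u)
    (hScontr : ∀ t : ℝ, 0 ≤ t → ∀ u : Lp ℝ 1 m, ‖S t u‖ ≤ ‖u‖)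
    (hScont : ∀ u : Lp ℝ 1 m, ContinuousOn (fun t => S t u) (Set.Ici 0))
    (domA : Set (Lp ℝ 1 m)) (A : Lp ℝ 1 m → Lp ℝ 1 m)
    (hdomA : domA = {u | ∃ v : Lp ℝ 1 m,
      Tendsto (fun t : ℝ => t⁻¹ • (S t u - u)) (nhdsWithin 0 (Set.Ioi 0)) (nhds v)})
    (hA : ∀ u ∈ domA,
      Tendsto (fun t : ℝ => t⁻¹ • (S t u - u)) (nhdsWithin 0 (Set.Ioi 0)) (nhds (A u)))
    (R : ℝ → Lp ℝ 1 m → Lp ℝ 1 m)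
    (hR : ∀ l : ℝ, 0 < l → ∀ u : Lp ℝ 1 m,
      R l u = ∫ t in Set.Ioi (0 : ℝ), Real.exp (-l * t) • S t u)
    (hRmem : ∀ l : ℝ, 0 < l → ∀ u : Lp ℝ 1 m, R l u ∈ domA)
    (hRA : ∀ l : ℝ, 0 < l → ∀ u : Lp ℝ 1 m, A (R l u) = l • R l u - u)
    (B : Lp ℝ 1 m → Lp ℝ 1 m)
    (hBadd : ∀ u ∈ domA, ∀ v ∈ domA, B (u + v) = B u + B v)
    (hBsmul : ∀ (c : ℝ), ∀ u ∈ domA, B (c • u) = c • B u)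
    (hBpos : ∀ u ∈ domA, 0 ≤ u → 0 ≤ B u)
    (hABint : ∀ u ∈ domA, 0 ≤ u → ∫ x, (A u x + B u x) ∂m = 0)
    (T : ℝ → Lp ℝ 1 m → Lp ℝ 1 m)
    (hT : ∀ (l : ℝ) (u : Lp ℝ 1 m), T l u = B (R l u))
    (hTpos : ∀ l : ℝ, 0 < l → ∀ u : Lp ℝ 1 m, 0 ≤ u → 0 ≤ T l u)
    (hTcontr : ∀ l : ℝ, 0 < l → ∀ u : Lp ℝ 1 m, ‖T l u‖ ≤ ‖u‖)
    (l : ℝ) (hl : 0 < l) :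
    ((∀ u : Lp ℝ 1 m, ∃ v : Lp ℝ 1 m,
        Tendsto (fun N : ℕ => (N : ℝ)⁻¹ • ∑ n ∈ Finset.range N, (T l)^[n] u) atTop (nhds v)) ↔
      (∀ u : Lp ℝ 1 m, Tendsto (fun n : ℕ => ‖(T l)^[n] u‖) atTop (nhds 0))) ∧
    ((∃ u : Lp ℝ 1 m, 0 ≤ u ∧ (∀ᵐ x ∂m, 0 < u x) ∧
        Tendsto (fun n : ℕ => ‖(T l)^[n] u‖) atTop (nhds 0)) ↔
      (∀ u : Lp ℝ 1 m, Tendsto (fun n : ℕ => ‖(T l)^[n] u‖) atTop (nhds 0))) := by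
  have hint (u : Lp ℝ 1 m) :
      IntegrableOn (fun t => Real.exp (-l * t) • S t u) (Set.Ioi 0) :=
    L1.integrableOn_exp_smul (hScont u) (fun t ht => hScontr t ht u) hl
  have hRadd (u v : Lp ℝ 1 m) : R l (u + v) = R l u + R l v := by
    simp only [hR l hl, map_add, smul_add]
    exact integral_add (hint u) (hint v)
  have hRsmul (c : ℝ) (u : Lp ℝ 1 m) : R l (c • u) = c • R l u := by
    simp only [hR l hl, map_smul, smul_comm _ c]
    exact integral_smul c _
  have hRpos (u : Lp ℝ 1 m) (hu : 0 ≤ u) : 0 ≤ R l u := by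
    rw [hR l hl]
    refine integral_nonneg_of_ae ?_
    filter_upwards [ae_restrict_mem measurableSet_Ioi] with t ht
    exact smul_nonneg (Real.exp_pos _).le (hSpos t (Set.mem_Ioi.1 ht).le u hu)
  obtain ⟨P, hP⟩ : ∃ P : Lp ℝ 1 m →ₗ[ℝ] Lp ℝ 1 m, T l = P :=
    ⟨{ toFun := T l
       map_add' := fun u v => by
        rw [hT, hT, hT, hRadd, hBadd _ (hRmem l hl u) _ (hRmem l hl v)]
       map_smul' := fun c u => by
        rw [hT, hT, hRsmul, hBsmul c _ (hRmem l hl u), RingHom.id_apply] }, rfl⟩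
  have hbalance (u : Lp ℝ 1 m) (hu : 0 ≤ u) : l * ‖R l u‖ + ‖T l u‖ = ‖u‖ := by
    have hR0 := hRpos u hu
    have h := hABint _ (hRmem l hl u) hR0
    rw [hRA l hl, ← hT, integral_add (L1.integrable_coeFn _) (L1.integrable_coeFn _),
      integral_congr_ae (Lp.coeFn_sub _ _)] at h
    simp only [Pi.sub_apply] at h
    rw [integral_sub (L1.integrable_coeFn _) (L1.integrable_coeFn _),
      ← L1.norm_eq_integral_of_nonneg hu, ← L1.norm_eq_integral_of_nonneg (hTpos l hl u hu),
      ← L1.norm_eq_integral_of_nonneg (smul_nonneg hl.le hR0), norm_smul,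
      Real.norm_of_nonneg hl.le] at h
    linarith
  have hA0 (h0 : (0 : Lp ℝ 1 m) ∈ domA) : A 0 = 0 :=
    tendsto_nhds_unique (hA 0 h0) (by simp)
  have hfix (v : Lp ℝ 1 m) (hv : 0 ≤ v) (hTv : T l v = v) : v = 0 := by
    have h := hbalance v hv
    rw [hTv, add_eq_right, mul_eq_zero, norm_eq_zero, or_iff_right hl.ne'] at h
    have hmem := hRmem l hl v
    have hAR := hRA l hl v
    rw [h] at hmem hAR
    rw [hA0 hmem, smul_zero, zero_sub] at hAR
    exact neg_eq_zero.1 hAR.symm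
  have hpos := hTpos l hl
  have hcontr := hTcontr l hl
  rw [hP] at hfix hpos hcontr ⊢
  refine ⟨⟨L1.tendsto_norm_iterate_of_cesaro hpos hcontr hfix, fun h u => ⟨0, ?_⟩⟩,
    ⟨fun ⟨u, _, hu, hlim⟩ => L1.tendsto_norm_iterate_of_pos hpos hcontr hu hlim, fun h => ?_⟩⟩
  · exact (tendsto_zero_iff_norm_tendsto_zero.2 (h u)).cesaro_smul
  · obtain ⟨u, hu0, hu⟩ := L1.exists_pos m
    exact ⟨u, hu0, hu, h u⟩
end

section
/- For every λ > 0 and every u ∈ L¹ with u ≥ 0 m-a.e., the sequence (‖T_λⁿu‖)_{n≥0} is non-increasing, the partial sums Σ_{n=0}^N R(λ)(T_λⁿu) converge in L¹-norm as N → ∞ to some v_λ(u) ≥ 0, and λ‖v_λ(u)‖ = ‖u‖ − lim_{n→∞}‖T_λⁿu‖. -/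
open MeasureTheory Filter

theorem isOrderedModule_L1_s9 {E : Type*} [MeasurableSpace E] (m : Measure E) :
    IsOrderedModule ℝ (Lp ℝ 1 m) :=
  .of_smul_nonneg fun c hc u hu => by
    rw [← Lp.coeFn_nonneg] at hu ⊢
    filter_upwards [hu, Lp.coeFn_smul c u] with x hx hcx
    rw [hcx]
    exact mul_nonneg hc hx

theorem norm_eq_integral_of_nonneg_L1 {E : Type*} [MeasurableSpace E] {m : Measure E}
    {u : Lp ℝ 1 m} (hu : 0 ≤ u) : ‖u‖ = ∫ x, u x ∂m := by
  rw [L1.norm_eq_integral_norm]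
  refine integral_congr_ae ?_
  filter_upwards [(Lp.coeFn_nonneg u).2 hu] with x hx
  exact Real.norm_of_nonneg hx

theorem norm_sum_of_nonneg_L1 {E : Type*} [MeasurableSpace E] {m : Measure E}
    {f : ℕ → Lp ℝ 1 m} (hf : ∀ n, 0 ≤ f n) (N : ℕ) :
    ‖∑ n ∈ Finset.range N, f n‖ = ∑ n ∈ Finset.range N, ‖f n‖ := by
  induction N with
  | zero => simp
  | succ N ih =>
    have hs : 0 ≤ ∑ n ∈ Finset.range N, f n := Finset.sum_nonneg fun n _ => hf n
    rw [Finset.sum_range_succ, Finset.sum_range_succ, ← ih,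
      norm_eq_integral_of_nonneg_L1 (add_nonneg hs (hf N)),
      norm_eq_integral_of_nonneg_L1 hs, norm_eq_integral_of_nonneg_L1 (hf N),
      integral_congr_ae (Lp.coeFn_add _ _)]
    exact integral_add (L1.integrable_coeFn _) (L1.integrable_coeFn _)

/-- In the Kato–Voigt perturbation setting, for every `λ > 0` and `u ≥ 0`
in `L¹`: the sequence `(‖T_λⁿ u‖)` is non-increasing, the partial sums
`Σ_{n=0}^N R(λ)(T_λⁿ u)` converge in `L¹` to some `v_λ(u) ≥ 0`, and
`λ‖v_λ(u)‖ = ‖u‖ − limₙ ‖T_λⁿ u‖`. -/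
theorem resolvent_series_converges
    {E : Type*} [MeasurableSpace E] (m : Measure E) [SigmaFinite m]
    (S : ℝ → Lp ℝ 1 m →L[ℝ] Lp ℝ 1 m)
    (hS0 : S 0 = 1)
    (hSsemi : ∀ s t : ℝ, 0 ≤ s → 0 ≤ t → S (s + t) = (S s).comp (S t))
    (hSpos : ∀ t : ℝ, 0 ≤ t → ∀ u : Lp ℝ 1 m, 0 ≤ u → 0 ≤ S t u)
    (hScontr : ∀ t : ℝ, 0 ≤ t → ∀ u : Lp ℝ 1 m, ‖S t u‖ ≤ ‖u‖)
    (hScont : ∀ u : Lp ℝ 1 m, ContinuousOn (fun t => S t u) (Set.Ici 0))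
    (domA : Set (Lp ℝ 1 m)) (A : Lp ℝ 1 m → Lp ℝ 1 m)
    (hdomA : domA = {u | ∃ v : Lp ℝ 1 m,
      Tendsto (fun t : ℝ => t⁻¹ • (S t u - u)) (nhdsWithin 0 (Set.Ioi 0)) (nhds v)})
    (hA : ∀ u ∈ domA,
      Tendsto (fun t : ℝ => t⁻¹ • (S t u - u)) (nhdsWithin 0 (Set.Ioi 0)) (nhds (A u)))
    (R : ℝ → Lp ℝ 1 m → Lp ℝ 1 m)
    (hR : ∀ l : ℝ, 0 < l → ∀ u : Lp ℝ 1 m,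
      R l u = ∫ t in Set.Ioi (0 : ℝ), Real.exp (-l * t) • S t u)
    (hRmem : ∀ l : ℝ, 0 < l → ∀ u : Lp ℝ 1 m, R l u ∈ domA)
    (hRA : ∀ l : ℝ, 0 < l → ∀ u : Lp ℝ 1 m, A (R l u) = l • R l u - u)
    (B : Lp ℝ 1 m → Lp ℝ 1 m)
    (hBadd : ∀ u ∈ domA, ∀ v ∈ domA, B (u + v) = B u + B v)
    (hBsmul : ∀ (c : ℝ), ∀ u ∈ domA, B (c • u) = c • B u)
    (hBpos : ∀ u ∈ domA, 0 ≤ u → 0 ≤ B u)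
    (hABint : ∀ u ∈ domA, 0 ≤ u → ∫ x, (A u x + B u x) ∂m = 0)
    (T : ℝ → Lp ℝ 1 m → Lp ℝ 1 m)
    (hT : ∀ (l : ℝ) (u : Lp ℝ 1 m), T l u = B (R l u))
    (hTpos : ∀ l : ℝ, 0 < l → ∀ u : Lp ℝ 1 m, 0 ≤ u → 0 ≤ T l u)
    (hTcontr : ∀ l : ℝ, 0 < l → ∀ u : Lp ℝ 1 m, ‖T l u‖ ≤ ‖u‖)
    :
    ∀ l : ℝ, 0 < l → ∀ u : Lp ℝ 1 m, 0 ≤ u →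
      Antitone (fun n : ℕ => ‖(T l)^[n] u‖) ∧
      ∃ w : Lp ℝ 1 m, 0 ≤ w ∧
        Tendsto (fun N : ℕ => ∑ n ∈ Finset.range N, R l ((T l)^[n] u)) atTop (nhds w) ∧
        ∃ c : ℝ, Tendsto (fun n : ℕ => ‖(T l)^[n] u‖) atTop (nhds c) ∧
          l * ‖w‖ = ‖u‖ - c := by
  intro l hl u hu
  have := isOrderedModule_L1_s9 m
  have hRpos : ∀ f : Lp ℝ 1 m, 0 ≤ f → 0 ≤ R l f := fun f hf => by
    rw [hR l hl f]
    refine integral_nonneg_of_ae ?_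
    filter_upwards [ae_restrict_mem measurableSet_Ioi] with t ht
    exact smul_nonneg (Real.exp_pos _).le (hSpos t (le_of_lt ht) f hf)
  have hnorm : ∀ f : Lp ℝ 1 m, 0 ≤ f → l * ‖R l f‖ = ‖f‖ - ‖T l f‖ := fun f hf => by
    have h := hABint (R l f) (hRmem l hl f) (hRpos f hf)
    rw [integral_add (L1.integrable_coeFn _) (L1.integrable_coeFn _), hRA l hl f,
      integral_congr_ae (Lp.coeFn_sub _ _), ← hT] at h
    simp only [Pi.sub_apply] at h
    rw [integral_sub (L1.integrable_coeFn _) (L1.integrable_coeFn _),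
      integral_congr_ae (Lp.coeFn_smul _ _)] at h
    simp only [Pi.smul_apply, smul_eq_mul] at h
    rw [integral_const_mul, ← norm_eq_integral_of_nonneg_L1 (hRpos f hf),
      ← norm_eq_integral_of_nonneg_L1 hf,
      ← norm_eq_integral_of_nonneg_L1 (hTpos l hl f hf)] at h
    linarith
  have hiter : ∀ n : ℕ, 0 ≤ (T l)^[n] u := fun n => by
    induction n with
    | zero => exact hu
    | succ n ih => rw [Function.iterate_succ_apply']; exact hTpos l hl _ ih
  have hanti : Antitone (fun n : ℕ => ‖(T l)^[n] u‖) := antitone_nat_of_succ_le fun n => by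
    rw [Function.iterate_succ_apply']; exact hTcontr l hl _
  have hlim := tendsto_atTop_ciInf hanti ⟨0, by rintro _ ⟨n, rfl⟩; exact norm_nonneg _⟩
  set c := ⨅ n : ℕ, ‖(T l)^[n] u‖
  have hterm : ∀ n, 0 ≤ R l ((T l)^[n] u) := fun n => hRpos _ (hiter n)
  have hsum : ∀ N : ℕ, ∑ n ∈ Finset.range N, ‖R l ((T l)^[n] u)‖
      = l⁻¹ * (‖u‖ - ‖(T l)^[N] u‖) := fun N => by
    rw [eq_inv_mul_iff_mul_eq₀ hl.ne', Finset.mul_sum]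
    simp_rw [fun n => hnorm _ (hiter n), ← Function.iterate_succ_apply']
    exact Finset.sum_range_sub' (fun n => ‖(T l)^[n] u‖) N
  have hsumlim : Tendsto (fun N : ℕ => ∑ n ∈ Finset.range N, ‖R l ((T l)^[n] u)‖) atTop
      (nhds (l⁻¹ * (‖u‖ - c))) := by
    simp_rw [hsum]
    exact (hlim.const_sub _).const_mul _
  have hsummable : Summable (fun n => ‖R l ((T l)^[n] u)‖) :=
    ((hasSum_iff_tendsto_nat_of_nonneg (fun _ => norm_nonneg _) _).2 hsumlim).summable
  have hw := hsummable.of_norm.hasSum.tendsto_sum_nat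
  refine ⟨hanti, _, tsum_nonneg hterm, hw, c, hlim, ?_⟩
  have hwnorm := hw.norm
  simp_rw [norm_sum_of_nonneg_L1 hterm] at hwnorm
  rw [tendsto_nhds_unique hwnorm hsumlim, mul_inv_cancel_left₀ hl.ne']
end

section
/- If the operator K defined by Ku = lim_{k→∞} T_{1/k}u (limit in L¹-norm, which exists for every u ∈ L¹) is mean ergodic, then for every λ > 0 and every u ∈ L¹, ‖T_λⁿu‖ → 0 as n → ∞ (i.e. the minimal Kato–Voigt semigroup is stochastic). -/
open MeasureTheory Filter

section AdditiveNorm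

variable {X : Type*} [NormedAddCommGroup X] [PartialOrder X] [IsOrderedAddMonoid X]

theorem norm_sub_of_additive_norm
    (hadd : ∀ u v : X, 0 ≤ u → 0 ≤ v → ‖u + v‖ = ‖u‖ + ‖v‖) {u v : X} (hu : 0 ≤ u)
    (huv : u ≤ v) : ‖v - u‖ = ‖v‖ - ‖u‖ := by
  have h := hadd u (v - u) hu (sub_nonneg.2 huv)
  rw [add_sub_cancel] at h
  linarith

theorem norm_le_of_additive_norm
    (hadd : ∀ u v : X, 0 ≤ u → 0 ≤ v → ‖u + v‖ = ‖u‖ + ‖v‖) {u v : X} (hu : 0 ≤ u)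
    (huv : u ≤ v) : ‖u‖ ≤ ‖v‖ := by
  linarith [norm_sub_of_additive_norm hadd hu huv, norm_nonneg (v - u)]

theorem norm_sum_of_additive_norm
    (hadd : ∀ u v : X, 0 ≤ u → 0 ≤ v → ‖u + v‖ = ‖u‖ + ‖v‖) {f : ℕ → X}
    (hf : ∀ n, 0 ≤ f n) (N : ℕ) :
    ‖∑ n ∈ Finset.range N, f n‖ = ∑ n ∈ Finset.range N, ‖f n‖ := by
  induction N with
  | zero => simp
  | succ N ih =>
    rw [Finset.sum_range_succ, Finset.sum_range_succ,
      hadd _ _ (Finset.sum_nonneg fun n _ => hf n) (hf N), ih]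

/-- If the norm is additive on the positive cone, decreasing positive sequences converge. -/
theorem exists_tendsto_of_antitone_of_additive_norm [CompleteSpace X]
    (hadd : ∀ u v : X, 0 ≤ u → 0 ≤ v → ‖u + v‖ = ‖u‖ + ‖v‖) {f : ℕ → X}
    (hf : ∀ n, 0 ≤ f n) (hanti : Antitone f) : ∃ w, Tendsto f atTop (nhds w) := by
  have hnorm : Antitone fun n => ‖f n‖ := fun i j hij =>
    norm_le_of_additive_norm hadd (hf j) (hanti hij)
  have hlim := tendsto_atTop_ciInf hnorm ⟨0, by rintro _ ⟨n, rfl⟩; exact norm_nonneg _⟩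
  have hcauchy := hlim.cauchySeq
  refine cauchySeq_tendsto_of_complete (Metric.cauchySeq_iff.2 fun ε hε => ?_)
  obtain ⟨N, hN⟩ := Metric.cauchySeq_iff.1 hcauchy ε hε
  refine ⟨N, fun i hi j hj => lt_of_le_of_lt ?_ (hN i hi j hj)⟩
  rw [dist_eq_norm, Real.dist_eq]
  rcases le_total i j with hij | hij
  · rw [norm_sub_of_additive_norm hadd (hf j) (hanti hij)]
    exact le_abs_self _
  · rw [norm_sub_rev, norm_sub_of_additive_norm hadd (hf i) (hanti hij), abs_sub_comm]
    exact le_abs_self _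

variable [NormedSpace ℝ X]

theorem ContinuousLinearMap.monotone_of_nonneg {T : X →L[ℝ] X}
    (hT : ∀ u, 0 ≤ u → 0 ≤ T u) : Monotone T := fun u v huv => by
  simpa using hT (v - u) (sub_nonneg.2 huv)

variable [OrderClosedTopology X]

theorem tendsto_pow_of_map_le [CompleteSpace X]
    (hadd : ∀ u v : X, 0 ≤ u → 0 ≤ v → ‖u + v‖ = ‖u‖ + ‖v‖) {T : X →L[ℝ] X}
    (hT : ∀ u, 0 ≤ u → 0 ≤ T u) (hfix : ∀ w, 0 ≤ w → T w = w → w = 0) {v : X}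
    (hv : 0 ≤ v) (hTv : T v ≤ v) : Tendsto (fun n => T^[n] v) atTop (nhds 0) := by
  have hpos : ∀ n, 0 ≤ T^[n] v := fun n => by
    induction n with
    | zero => exact hv
    | succ n ih => rw [Function.iterate_succ_apply']; exact hT _ ih
  have hanti : Antitone fun n => T^[n] v := antitone_nat_of_succ_le fun n => by
    rw [Function.iterate_succ_apply]
    exact (ContinuousLinearMap.monotone_of_nonneg hT).iterate n hTv
  obtain ⟨w, hw⟩ := exists_tendsto_of_antitone_of_additive_norm hadd hpos hanti
  have hTw : T w = w := by
    refine tendsto_nhds_unique ?_ (hw.comp (tendsto_add_atTop_nat 1))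
    refine ((T.continuous.tendsto w).comp hw).congr fun n => ?_
    exact (Function.iterate_succ_apply' T n v).symm
  rwa [hfix w (ge_of_tendsto' hw hpos) hTw] at hw

/-- A positive operator without nonzero positive fixed points which is dominated on the positive
cone by a contraction `K` has vanishing powers at each positive point where the Cesàro averages of
`K` converge. -/
theorem tendsto_pow_of_dominated_cesaro [CompleteSpace X] [IsOrderedModule ℝ X]
    (hadd : ∀ u v : X, 0 ≤ u → 0 ≤ v → ‖u + v‖ = ‖u‖ + ‖v‖) {T : X →L[ℝ] X}
    (hT : ∀ u, 0 ≤ u → 0 ≤ T u) (hTle : ∀ u, ‖T u‖ ≤ ‖u‖)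
    (hfix : ∀ w, 0 ≤ w → T w = w → w = 0)
    {K : X → X} (hTK : ∀ u, 0 ≤ u → T u ≤ K u) (hK : ∀ u, ‖K u‖ ≤ ‖u‖) {u v : X} (hu : 0 ≤ u)
    (hv : Tendsto (fun N : ℕ => (N : ℝ)⁻¹ • ∑ n ∈ Finset.range N, K^[n] u) atTop (nhds v)) :
    Tendsto (fun n => T^[n] u) atTop (nhds 0) := by
  have hmono := ContinuousLinearMap.monotone_of_nonneg hT
  have hTpos : ∀ n x, 0 ≤ x → 0 ≤ T^[n] x := fun n x hx => by
    simpa [iterate_map_zero] using hmono.iterate n hx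
  have hKpos : ∀ n, 0 ≤ K^[n] u := fun n => by
    induction n with
    | zero => exact hu
    | succ n ih => rw [Function.iterate_succ_apply']; exact (hT _ ih).trans (hTK _ ih)
  have hKnorm : ∀ n, ‖K^[n] u‖ ≤ ‖u‖ := fun n => by
    induction n with
    | zero => exact le_rfl
    | succ n ih => rw [Function.iterate_succ_apply']; exact (hK _).trans ih
  have hdom : ∀ n k, T^[k + n] u ≤ T^[k] (K^[n] u) := fun n => by
    induction n with
    | zero => exact fun k => le_rfl
    | succ n ih =>
      intro k
      have h1 := ih (k + 1)
      rw [Function.iterate_succ_apply, Nat.add_right_comm] at h1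
      rw [Function.iterate_succ_apply' K]
      exact h1.trans (hmono.iterate k (hTK _ (hKpos n)))
  have hvpos : 0 ≤ v := ge_of_tendsto' hv fun N =>
    smul_nonneg (by positivity) (Finset.sum_nonneg fun n _ => hKpos n)
  have hTv : T v ≤ v := by
    have hrem : Tendsto (fun N : ℕ => (N : ℝ)⁻¹ • (K^[N] u - u)) atTop (nhds 0) := by
      refine squeeze_zero_norm (a := fun N : ℕ => (N : ℝ)⁻¹ * (‖u‖ + ‖u‖)) (fun N => ?_) ?_
      · rw [norm_smul, Real.norm_of_nonneg (by positivity)]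
        gcongr
        exact (norm_sub_le _ _).trans (by gcongr; exact hKnorm N)
      · simpa using tendsto_inv_atTop_nhds_zero_nat.mul_const (‖u‖ + ‖u‖)
    have hlim := hv.add hrem
    rw [add_zero] at hlim
    refine le_of_tendsto_of_tendsto' ((T.continuous.tendsto v).comp hv) hlim fun N => ?_
    have hshift : (∑ n ∈ Finset.range N, K^[n] u) + (K^[N] u - u)
        = ∑ n ∈ Finset.range N, K^[n + 1] u := by
      have h := (Finset.sum_range_succ (fun n => K^[n] u) N).symm.trans
        (Finset.sum_range_succ' (fun n => K^[n] u) N)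
      rw [← add_sub_assoc, h]
      simp
    rw [← smul_add, hshift, Function.comp_apply, map_smul, map_sum]
    refine smul_le_smul_of_nonneg_left (Finset.sum_le_sum fun n _ => ?_) (by positivity)
    rw [Function.iterate_succ_apply']
    exact hTK _ (hKpos n)
  have hnorm : Antitone fun n => ‖T^[n] u‖ := antitone_nat_of_succ_le fun n => by
    rw [Function.iterate_succ_apply']; exact hTle _
  have hbdd : BddBelow (Set.range fun n => ‖T^[n] u‖) :=
    ⟨0, by rintro _ ⟨n, rfl⟩; exact norm_nonneg _⟩
  have hinf := tendsto_atTop_ciInf hnorm hbdd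
  set c := ⨅ n, ‖T^[n] u‖
  have hc : ∀ k, c ≤ ‖T^[k] v‖ := fun k => by
    refine ge_of_tendsto ((((T.continuous.iterate k).tendsto v).comp hv).norm)
      ((eventually_ge_atTop 1).mono fun N hN => ?_)
    have hN' : (0 : ℝ) < N := by exact_mod_cast hN
    have hlin : T^[k] ((N : ℝ)⁻¹ • ∑ n ∈ Finset.range N, K^[n] u)
        = (N : ℝ)⁻¹ • ∑ n ∈ Finset.range N, T^[k] (K^[n] u) := by
      rw [← FunLike.coe_pow_eq_iterate, map_smul, map_sum]
    rw [Function.comp_apply, hlin, norm_smul, Real.norm_of_nonneg (by positivity),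
      norm_sum_of_additive_norm hadd fun n => hTpos k _ (hKpos n), inv_mul_eq_div, le_div_iff₀ hN']
    calc c * N = ∑ _n ∈ Finset.range N, c := by simp [mul_comm]
      _ ≤ _ := Finset.sum_le_sum fun n _ => (ciInf_le hbdd (k + n)).trans
        (norm_le_of_additive_norm hadd (hTpos _ _ hu) (hdom n k))
  have hc0 : c ≤ 0 := by
    simpa using ge_of_tendsto' (tendsto_pow_of_map_le hadd hT hfix hvpos hTv).norm hc
  have : c = 0 := le_antisymm hc0 (le_ciInf fun n => norm_nonneg _)
  rw [this] at hinf
  exact tendsto_zero_iff_norm_tendsto_zero.2 hinf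

end AdditiveNorm

namespace MeasureTheory

variable {E : Type*} [MeasurableSpace E] {m : Measure E}

instance Lp.instIsOrderedModuleReal {p : ENNReal} : IsOrderedModule ℝ (Lp ℝ p m) :=
  IsOrderedModule.of_smul_nonneg fun c hc u hu => by
    rw [← Lp.coeFn_nonneg] at hu ⊢
    filter_upwards [hu, Lp.coeFn_smul c u] with x hx hcx
    rw [hcx]
    exact mul_nonneg hc hx

theorem L1.norm_eq_integral_of_nonneg_s12 {u : Lp ℝ 1 m} (hu : 0 ≤ u) : ‖u‖ = ∫ x, u x ∂m := by
  rw [L1.norm_eq_integral_norm]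
  refine integral_congr_ae ?_
  filter_upwards [(Lp.coeFn_nonneg u).2 hu] with x hx
  exact Real.norm_of_nonneg hx

theorem L1.norm_add_of_nonneg_s12 (u v : Lp ℝ 1 m) (hu : 0 ≤ u) (hv : 0 ≤ v) :
    ‖u + v‖ = ‖u‖ + ‖v‖ := by
  rw [L1.norm_eq_integral_of_nonneg_s12 hu, L1.norm_eq_integral_of_nonneg_s12 hv,
    L1.norm_eq_integral_of_nonneg_s12 (add_nonneg hu hv),
    ← MeasureTheory.integral_add (L1.integrable_coeFn u) (L1.integrable_coeFn v)]
  exact integral_congr_ae (Lp.coeFn_add u v)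

end MeasureTheory

theorem integrableOn_exp_smul_contraction {X : Type*} [NormedAddCommGroup X] [NormedSpace ℝ X]
    {f : ℝ → X} (hf : ContinuousOn f (Set.Ici 0)) {C : ℝ} (hC : ∀ t, 0 ≤ t → ‖f t‖ ≤ C) {l : ℝ}
    (hl : 0 < l) : IntegrableOn (fun t => Real.exp (-l * t) • f t) (Set.Ioi 0) := by
  refine Integrable.mono' ((exp_neg_integrableOn_Ioi 0 hl).mul_const C) ?_ ?_
  · refine ContinuousOn.aestronglyMeasurable ?_ measurableSet_Ioi
    exact ContinuousOn.smul (by fun_prop) (hf.mono Set.Ioi_subset_Ici_self)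
  · refine (ae_restrict_iff' measurableSet_Ioi).2 (ae_of_all _ fun t ht => ?_)
    rw [norm_smul, Real.norm_of_nonneg (Real.exp_nonneg _)]
    gcongr
    exact hC t (le_of_lt ht)

section LaplaceTransform

variable {X : Type*} [NormedAddCommGroup X] [NormedSpace ℝ X] [PartialOrder X]
  [IsOrderedAddMonoid X] [IsOrderedModule ℝ X] [OrderClosedTopology X] {f : ℝ → X}

theorem setIntegral_exp_smul_nonneg (hf : ∀ t, 0 ≤ t → 0 ≤ f t) (l : ℝ) :
    0 ≤ ∫ t in Set.Ioi (0 : ℝ), Real.exp (-l * t) • f t := by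
  refine integral_nonneg_of_ae ((ae_restrict_iff' measurableSet_Ioi).2 (ae_of_all _ ?_))
  exact fun t ht => smul_nonneg (Real.exp_nonneg _) (hf t (le_of_lt ht))

theorem setIntegral_exp_smul_anti (hf : ∀ t, 0 ≤ t → 0 ≤ f t) {l l' : ℝ} (hll' : l ≤ l')
    (hl : IntegrableOn (fun t => Real.exp (-l * t) • f t) (Set.Ioi 0))
    (hl' : IntegrableOn (fun t => Real.exp (-l' * t) • f t) (Set.Ioi 0)) :
    ∫ t in Set.Ioi (0 : ℝ), Real.exp (-l' * t) • f t
      ≤ ∫ t in Set.Ioi (0 : ℝ), Real.exp (-l * t) • f t := by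
  refine setIntegral_mono_on hl' hl measurableSet_Ioi fun t ht => ?_
  have ht' : (0 : ℝ) ≤ t := le_of_lt ht
  refine smul_le_smul_of_nonneg_right ?_ (hf t ht')
  gcongr

end LaplaceTransform

/-- In the Kato–Voigt perturbation setting, if the operator
`K u = lim_k T_{1/k} u` (limit in `L¹`-norm, existing for every `u`) is mean ergodic, then
for every `λ > 0` and every `u ∈ L¹`, `‖T_λⁿ u‖ → 0` (i.e. the minimal Kato–Voigt semigroup
is stochastic). -/
theorem stochastic_of_K_mean_ergodic
    {E : Type*} [MeasurableSpace E] (m : Measure E) [SigmaFinite m]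
    (S : ℝ → Lp ℝ 1 m →L[ℝ] Lp ℝ 1 m)
    (hS0 : S 0 = 1)
    (hSsemi : ∀ s t : ℝ, 0 ≤ s → 0 ≤ t → S (s + t) = (S s).comp (S t))
    (hSpos : ∀ t : ℝ, 0 ≤ t → ∀ u : Lp ℝ 1 m, 0 ≤ u → 0 ≤ S t u)
    (hScontr : ∀ t : ℝ, 0 ≤ t → ∀ u : Lp ℝ 1 m, ‖S t u‖ ≤ ‖u‖)
    (hScont : ∀ u : Lp ℝ 1 m, ContinuousOn (fun t => S t u) (Set.Ici 0))
    (domA : Set (Lp ℝ 1 m)) (A : Lp ℝ 1 m → Lp ℝ 1 m)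
    (hdomA : domA = {u | ∃ v : Lp ℝ 1 m,
      Tendsto (fun t : ℝ => t⁻¹ • (S t u - u)) (nhdsWithin 0 (Set.Ioi 0)) (nhds v)})
    (hA : ∀ u ∈ domA,
      Tendsto (fun t : ℝ => t⁻¹ • (S t u - u)) (nhdsWithin 0 (Set.Ioi 0)) (nhds (A u)))
    (R : ℝ → Lp ℝ 1 m → Lp ℝ 1 m)
    (hR : ∀ l : ℝ, 0 < l → ∀ u : Lp ℝ 1 m,
      R l u = ∫ t in Set.Ioi (0 : ℝ), Real.exp (-l * t) • S t u)
    (hRmem : ∀ l : ℝ, 0 < l → ∀ u : Lp ℝ 1 m, R l u ∈ domA)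
    (hRA : ∀ l : ℝ, 0 < l → ∀ u : Lp ℝ 1 m, A (R l u) = l • R l u - u)
    (B : Lp ℝ 1 m → Lp ℝ 1 m)
    (hBadd : ∀ u ∈ domA, ∀ v ∈ domA, B (u + v) = B u + B v)
    (hBsmul : ∀ (c : ℝ), ∀ u ∈ domA, B (c • u) = c • B u)
    (hBpos : ∀ u ∈ domA, 0 ≤ u → 0 ≤ B u)
    (hABint : ∀ u ∈ domA, 0 ≤ u → ∫ x, (A u x + B u x) ∂m = 0)
    (T : ℝ → Lp ℝ 1 m → Lp ℝ 1 m)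
    (hT : ∀ (l : ℝ) (u : Lp ℝ 1 m), T l u = B (R l u))
    (hTpos : ∀ l : ℝ, 0 < l → ∀ u : Lp ℝ 1 m, 0 ≤ u → 0 ≤ T l u)
    (hTcontr : ∀ l : ℝ, 0 < l → ∀ u : Lp ℝ 1 m, ‖T l u‖ ≤ ‖u‖)
    (K : Lp ℝ 1 m → Lp ℝ 1 m)
    (hK : ∀ u : Lp ℝ 1 m, Tendsto (fun k : ℕ => T (1 / (k : ℝ)) u) atTop (nhds (K u)))
    (hKme : ∀ u : Lp ℝ 1 m, ∃ v : Lp ℝ 1 m,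
      Tendsto (fun N : ℕ => (N : ℝ)⁻¹ • ∑ n ∈ Finset.range N, K^[n] u) atTop (nhds v)) :
    ∀ l : ℝ, 0 < l → ∀ u : Lp ℝ 1 m,
      Tendsto (fun n : ℕ => ‖(T l)^[n] u‖) atTop (nhds 0) := by
  have hexp_int : ∀ l : ℝ, 0 < l → ∀ u : Lp ℝ 1 m,
      IntegrableOn (fun t => Real.exp (-l * t) • S t u) (Set.Ioi 0) := fun l hl u =>
    integrableOn_exp_smul_contraction (hScont u) (fun t ht => hScontr t ht u) hl
  have hRadd : ∀ l : ℝ, 0 < l → ∀ u v, R l (u + v) = R l u + R l v := fun l hl u v => by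
    rw [hR l hl, hR l hl, hR l hl, ← integral_add (hexp_int l hl u) (hexp_int l hl v)]
    simp only [map_add, smul_add]
  have hRsmul : ∀ l : ℝ, 0 < l → ∀ (c : ℝ) u, R l (c • u) = c • R l u := fun l hl c u => by
    rw [hR l hl, hR l hl, ← integral_smul]
    simp only [map_smul, smul_comm c]
  have hRpos : ∀ l : ℝ, 0 < l → ∀ u, 0 ≤ u → 0 ≤ R l u := fun l hl u hu => by
    rw [hR l hl]
    exact setIntegral_exp_smul_nonneg (fun t ht => hSpos t ht u hu) l
  have hRanti : ∀ l : ℝ, 0 < l → ∀ l' : ℝ, l ≤ l' → ∀ u, 0 ≤ u → R l' u ≤ R l u :=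
    fun l hl l' hll' u hu => by
    rw [hR l hl, hR l' (hl.trans_le hll')]
    exact setIntegral_exp_smul_anti (fun t ht => hSpos t ht u hu) hll' (hexp_int l hl u)
      (hexp_int l' (hl.trans_le hll') u)
  have hdom_smul : ∀ (c : ℝ), ∀ u ∈ domA, c • u ∈ domA := fun c u hu => by
    rw [hdomA]
    refine ⟨c • A u, ((hA u hu).const_smul c).congr fun t => ?_⟩
    rw [map_smul, ← smul_sub, smul_comm]
  have hdom_add : ∀ u ∈ domA, ∀ v ∈ domA, u + v ∈ domA := fun u hu v hv => by
    rw [hdomA]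
    refine ⟨A u + A v, ((hA u hu).add (hA v hv)).congr fun t => ?_⟩
    rw [map_add, ← smul_add]
    congr 1
    abel
  have hBmono : ∀ u ∈ domA, ∀ v ∈ domA, u ≤ v → B u ≤ B v := fun u hu v hv huv => by
    have hnu := hdom_smul (-1) u hu
    have h := hBpos _ (hdom_add v hv _ hnu) (by simpa [← sub_eq_add_neg] using huv)
    rw [hBadd v hv _ hnu, hBsmul (-1) u hu] at h
    simpa [← sub_eq_add_neg] using h
  intro l hl
  obtain ⟨L, hL⟩ : ∃ L : Lp ℝ 1 m →L[ℝ] Lp ℝ 1 m, ⇑L = T l := ⟨LinearMap.mkContinuous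
    { toFun := T l
      map_add' := fun u v => by
        rw [hT, hT, hT, hRadd l hl, hBadd _ (hRmem l hl u) _ (hRmem l hl v)]
      map_smul' := fun c u => by
        rw [hT, hT, hRsmul l hl, hBsmul c _ (hRmem l hl u), RingHom.id_apply] } 1
    (fun u => by simpa using hTcontr l hl u), rfl⟩
  have hfix : ∀ w, 0 ≤ w → L w = w → w = 0 := fun w hw hLw => by
    have hBR : B (R l w) = w := by rw [← hT, ← hL, hLw]
    have h0 := hABint (R l w) (hRmem l hl w) (hRpos l hl w hw)
    have hRw : R l w = 0 := by
      rw [hRA l hl, hBR] at h0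
      replace h0 := (integral_congr_ae (Lp.coeFn_add (l • R l w - w) w)).trans h0
      rw [sub_add_cancel,
        ← L1.norm_eq_integral_of_nonneg_s12 (smul_nonneg hl.le (hRpos l hl w hw)), norm_eq_zero] at h0
      exact (smul_eq_zero.1 h0).resolve_left hl.ne'
    have hB0 := hBsmul 0 _ (hRmem l hl w)
    rw [zero_smul, zero_smul] at hB0
    rw [← hBR, hRw, hB0]
  have hLK : ∀ u, 0 ≤ u → L u ≤ K u := fun u hu => by
    have hsmall : ∀ᶠ k : ℕ in atTop, 1 / (k : ℝ) < l :=
      tendsto_one_div_atTop_nhds_zero_nat.eventually_lt_const hl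
    refine ge_of_tendsto (hK u) ?_
    filter_upwards [hsmall, eventually_gt_atTop 0] with k hk hk0
    have hkpos : (0 : ℝ) < 1 / (k : ℝ) := by positivity
    rw [hL, hT, hT]
    exact hBmono _ (hRmem l hl u) _ (hRmem _ hkpos u) (hRanti _ hkpos l hk.le u hu)
  have hKcontr : ∀ u, ‖K u‖ ≤ ‖u‖ := fun u => by
    refine le_of_tendsto (hK u).norm ((eventually_gt_atTop 0).mono fun k hk => ?_)
    exact hTcontr _ (by positivity) u
  have hpos : ∀ u, 0 ≤ u → Tendsto (fun n => L^[n] u) atTop (nhds 0) := fun u hu => by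
    obtain ⟨v, hv⟩ := hKme u
    exact tendsto_pow_of_dominated_cesaro L1.norm_add_of_nonneg_s12 (hL ▸ hTpos l hl)
      (hL ▸ hTcontr l hl) hfix hLK hKcontr hu hv
  intro u
  have h := ((hpos _ (posPart_nonneg u)).sub (hpos _ (negPart_nonneg u))).norm
  rw [sub_zero, norm_zero] at h
  have heq : ∀ n, ‖L^[n] u⁺ - L^[n] u⁻‖ = ‖(T l)^[n] u‖ := fun n => by
    rw [← hL, ← iterate_map_sub, posPart_sub_negPart]
  exact (tendsto_congr heq).1 h
end

section
/- Let φ : (0,∞) → (0,∞) be Borel measurable and bounded on bounded subsets of (0,∞) (i.e. sup_{0<x≤N} φ(x) < ∞ for every N > 0). For λ > 0 define T_λ u(x) = ∫_x^∞ b(x,y) (φ(y)/(λ + φ(y))) u(y) dy. Then for every λ > 0 and every u ∈ L¹((0,∞), x dx), ‖T_λⁿ u‖ → 0 as n → ∞ (equivalently, the minimal semigroup for the pure fragmentation equation ∂ₜu(t,x) = ∫_x^∞ b(x,y)φ(y)u(t,y)dy − φ(x)u(t,x) is stochastic). -/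
open MeasureTheory Filter Set
open scoped ENNReal

/-- The kernel operator `f ↦ ∫ K(·, y) f(y) dy` on `[0, ∞]`-valued functions. -/
noncomputable def kernelOp (K : ℝ → ℝ → ℝ≥0∞) (f : ℝ → ℝ≥0∞) (x : ℝ) : ℝ≥0∞ :=
  ∫⁻ y, K x y * f y

/-- The norm of `f` in `L¹((0,∞), x dx)`, as an extended nonnegative real. -/
noncomputable def massNorm (f : ℝ → ℝ≥0∞) : ℝ≥0∞ :=
  ∫⁻ x in Ioi (0 : ℝ), f x * ENNReal.ofReal x

section kernelOp

variable {K : ℝ → ℝ → ℝ≥0∞}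

lemma measurable_kernelOp (hK : Measurable (Function.uncurry K)) {f : ℝ → ℝ≥0∞}
    (hf : Measurable f) : Measurable (kernelOp K f) :=
  (hK.mul (hf.comp measurable_snd)).lintegral_prod_right'

lemma measurable_kernelOp_iterate (hK : Measurable (Function.uncurry K)) {f : ℝ → ℝ≥0∞}
    (hf : Measurable f) (n : ℕ) : Measurable ((kernelOp K)^[n] f) := by
  induction n with
  | zero => exact hf
  | succ n ih =>
    rw [Function.iterate_succ_apply']
    exact measurable_kernelOp hK ih

lemma kernelOp_add (hK : Measurable (Function.uncurry K)) {f : ℝ → ℝ≥0∞} (hf : Measurable f)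
    (g : ℝ → ℝ≥0∞) : kernelOp K (f + g) = kernelOp K f + kernelOp K g := by
  funext x
  simp only [kernelOp, Pi.add_apply, mul_add]
  exact lintegral_add_left ((hK.comp measurable_prodMk_left).mul hf) _

lemma kernelOp_iterate_add (hK : Measurable (Function.uncurry K)) {f : ℝ → ℝ≥0∞}
    (hf : Measurable f) (g : ℝ → ℝ≥0∞) (n : ℕ) :
    (kernelOp K)^[n] (f + g) = (kernelOp K)^[n] f + (kernelOp K)^[n] g := by
  induction n with
  | zero => rfl
  | succ n ih =>
    simp only [Function.iterate_succ_apply', ih]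
    exact kernelOp_add hK (measurable_kernelOp_iterate hK hf n) _

lemma kernelOp_eq_zero_of_lt (hsupp : ∀ x y, y ≤ x → K x y = 0) {f : ℝ → ℝ≥0∞} {N : ℝ}
    (hf : ∀ x, N < x → f x = 0) (x : ℝ) (hx : N < x) : kernelOp K f x = 0 := by
  have h (y : ℝ) : K x y * f y = 0 := by
    rcases le_or_gt y x with hy | hy
    · rw [hsupp x y hy, zero_mul]
    · rw [hf y (hx.trans hy), mul_zero]
  simp [kernelOp, h]

lemma kernelOp_iterate_eq_zero_of_lt (hsupp : ∀ x y, y ≤ x → K x y = 0) {f : ℝ → ℝ≥0∞} {N : ℝ}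
    (hf : ∀ x, N < x → f x = 0) (n : ℕ) : ∀ x, N < x → (kernelOp K)^[n] f x = 0 := by
  induction n with
  | zero => exact hf
  | succ n ih =>
    simp only [Function.iterate_succ_apply']
    exact kernelOp_eq_zero_of_lt hsupp ih

lemma massNorm_add {f : ℝ → ℝ≥0∞} (hf : Measurable f) (g : ℝ → ℝ≥0∞) :
    massNorm (f + g) = massNorm f + massNorm g := by
  simp only [massNorm, Pi.add_apply, add_mul]
  exact lintegral_add_left (hf.mul ENNReal.measurable_ofReal) _

lemma massNorm_kernelOp_le (hK : Measurable (Function.uncurry K))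
    (hsupp : ∀ x y, y ≤ x → K x y = 0) {f : ℝ → ℝ≥0∞} (hf : Measurable f) {c : ℝ≥0∞}
    (hc : ∀ y, 0 < y → f y ≠ 0 → massNorm (K · y) ≤ c * ENNReal.ofReal y) :
    massNorm (kernelOp K f) ≤ c * massNorm f := by
  have hK' (y : ℝ) : Measurable (K · y) := hK.comp measurable_prodMk_right
  have hKx (x : ℝ) : Measurable (K x) := hK.comp measurable_prodMk_left
  calc massNorm (kernelOp K f)
      = ∫⁻ x in Ioi (0 : ℝ), ∫⁻ y in Ioi (0 : ℝ), K x y * f y * ENNReal.ofReal x := by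
        refine setLIntegral_congr_fun measurableSet_Ioi fun x hx => ?_
        have hx : 0 < x := hx
        simp only [kernelOp]
        have hm : Measurable fun y => K x y * f y := (hKx x).mul hf
        rw [← lintegral_mul_const _ hm, setLIntegral_eq_of_support_subset]
        intro y hy
        by_contra hy0
        exact hy (by simp [hsupp x y ((not_lt.1 hy0).trans hx.le)])
    _ = ∫⁻ y in Ioi (0 : ℝ), ∫⁻ x in Ioi (0 : ℝ), K x y * f y * ENNReal.ofReal x := by
        refine lintegral_lintegral_swap (Measurable.aemeasurable ?_)
        exact (hK.mul (hf.comp measurable_snd)).mul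
          (ENNReal.measurable_ofReal.comp measurable_fst)
    _ ≤ ∫⁻ y in Ioi (0 : ℝ), c * (f y * ENNReal.ofReal y) := by
        refine setLIntegral_mono' measurableSet_Ioi fun y hy => ?_
        by_cases hfy : f y = 0
        · simp [hfy]
        calc ∫⁻ x in Ioi (0 : ℝ), K x y * f y * ENNReal.ofReal x
            = f y * massNorm (K · y) := by
              have hm : Measurable fun x => K x y * ENNReal.ofReal x :=
                (hK' y).mul ENNReal.measurable_ofReal
              rw [massNorm, ← lintegral_const_mul _ hm]
              exact lintegral_congr fun x => by ring
          _ ≤ f y * (c * ENNReal.ofReal y) := by gcongr; exact hc y hy hfy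
          _ = c * (f y * ENNReal.ofReal y) := by ring
    _ = c * massNorm f := lintegral_const_mul _ (hf.mul ENNReal.measurable_ofReal)

lemma massNorm_kernelOp_iterate_le (hK : Measurable (Function.uncurry K))
    (hsupp : ∀ x y, y ≤ x → K x y = 0) (hmass : ∀ y, 0 < y → massNorm (K · y) ≤ ENNReal.ofReal y)
    {f : ℝ → ℝ≥0∞} (hf : Measurable f) (n : ℕ) :
    massNorm ((kernelOp K)^[n] f) ≤ massNorm f := by
  induction n with
  | zero => rfl
  | succ n ih =>
    rw [Function.iterate_succ_apply']
    refine (massNorm_kernelOp_le hK hsupp (measurable_kernelOp_iterate hK hf n) (c := 1)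
      fun y hy _ => ?_).trans (by rwa [one_mul])
    rw [one_mul]
    exact hmass y hy

lemma massNorm_kernelOp_iterate_le_pow (hK : Measurable (Function.uncurry K))
    (hsupp : ∀ x y, y ≤ x → K x y = 0) {N : ℝ} {q : ℝ≥0∞}
    (hq : ∀ y, 0 < y → y ≤ N → massNorm (K · y) ≤ q * ENNReal.ofReal y)
    {f : ℝ → ℝ≥0∞} (hf : Measurable f) (hfN : ∀ x, N < x → f x = 0) (n : ℕ) :
    massNorm ((kernelOp K)^[n] f) ≤ q ^ n * massNorm f := by
  induction n with
  | zero => simp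
  | succ n ih =>
    rw [Function.iterate_succ_apply']
    refine (massNorm_kernelOp_le hK hsupp (measurable_kernelOp_iterate hK hf n) (c := q)
      fun y hy hne => hq y hy ?_).trans ?_
    · by_contra! h
      exact hne (kernelOp_iterate_eq_zero_of_lt hsupp hfN n y h)
    · calc q * massNorm ((kernelOp K)^[n] f) ≤ q * (q ^ n * massNorm f) := by gcongr
        _ = q ^ (n + 1) * massNorm f := by ring

lemma tendsto_massNorm_indicator_Ioi {f : ℝ → ℝ≥0∞} (hf : Measurable f) (hfin : massNorm f ≠ ∞) :
    Tendsto (fun N : ℕ => massNorm ((Ioi (N : ℝ)).indicator f)) atTop (nhds 0) := by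
  have h := tendsto_lintegral_of_dominated_convergence
    (μ := volume.restrict (Ioi (0 : ℝ)))
    (F := fun (N : ℕ) x => (Ioi (N : ℝ)).indicator f x * ENNReal.ofReal x) (f := fun _ => 0)
    (fun x => f x * ENNReal.ofReal x)
    (fun N => (hf.indicator measurableSet_Ioi).mul ENNReal.measurable_ofReal)
    (fun N => ae_of_all _ fun x => mul_le_mul_left (indicator_le_self _ _ x) _) hfin
    (ae_of_all _ fun x => ?_)
  · simpa [massNorm] using h
  · refine tendsto_const_nhds.congr' ?_
    filter_upwards [eventually_ge_atTop ⌈x⌉₊] with N hN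
    rw [indicator_of_notMem (by simpa using Nat.ceil_le.1 hN), zero_mul]

/-- A mass-nonincreasing kernel that transports mass downwards and strictly contracts on bounded
intervals has iterates converging strongly to zero. -/
theorem tendsto_massNorm_kernelOp_iterate (hK : Measurable (Function.uncurry K))
    (hsupp : ∀ x y, y ≤ x → K x y = 0) (hmass : ∀ y, 0 < y → massNorm (K · y) ≤ ENNReal.ofReal y)
    (hcontr : ∀ N : ℝ, 0 < N → ∃ q < (1 : ℝ≥0∞), ∀ y, 0 < y → y ≤ N →
      massNorm (K · y) ≤ q * ENNReal.ofReal y)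
    {f : ℝ → ℝ≥0∞} (hf : Measurable f) (hfin : massNorm f ≠ ∞) :
    Tendsto (fun n : ℕ => massNorm ((kernelOp K)^[n] f)) atTop (nhds 0) := by
  rw [ENNReal.tendsto_nhds_zero]
  intro ε hε
  have hε2 : 0 < ε / 2 := ENNReal.half_pos hε.ne'
  obtain ⟨N, hN, hN0⟩ := ((ENNReal.tendsto_nhds_zero.1
    (tendsto_massNorm_indicator_Ioi hf hfin) _ hε2).and (eventually_gt_atTop 0)).exists
  obtain ⟨q, hq1, hq⟩ := hcontr N (by exact_mod_cast hN0)
  have hpow : Tendsto (fun n : ℕ => q ^ n * massNorm f) atTop (nhds 0) := by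
    simpa using ENNReal.Tendsto.mul_const (ENNReal.tendsto_pow_atTop_nhds_zero_of_lt_one hq1)
      (Or.inr hfin)
  filter_upwards [ENNReal.tendsto_nhds_zero.1 hpow _ hε2] with n hn
  set g := (Iic (N : ℝ)).indicator f
  set h := (Ioi (N : ℝ)).indicator f
  have hg : Measurable g := hf.indicator measurableSet_Iic
  have hh : Measurable h := hf.indicator measurableSet_Ioi
  have hsplit : f = g + h := by
    rw [← indicator_self_add_compl (Iic (N : ℝ)) f, compl_Iic]
  have hgf : massNorm g ≤ massNorm f :=
    lintegral_mono fun x => mul_le_mul_left (indicator_le_self _ f x) _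
  have hgN (x : ℝ) (hx : (N : ℝ) < x) : g x = 0 := indicator_of_notMem (by simpa using hx) f
  calc massNorm ((kernelOp K)^[n] f)
      = massNorm ((kernelOp K)^[n] g) + massNorm ((kernelOp K)^[n] h) := by
        nth_rewrite 1 [hsplit]
        rw [kernelOp_iterate_add hK hg, massNorm_add (measurable_kernelOp_iterate hK hg n)]
    _ ≤ q ^ n * massNorm f + massNorm h := by
        gcongr
        · exact (massNorm_kernelOp_iterate_le_pow hK hsupp hq hg hgN n).trans (by gcongr)
        · exact massNorm_kernelOp_iterate_le hK hsupp hmass hh n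
    _ ≤ ε / 2 + ε / 2 := by gcongr
    _ = ε := ENNReal.add_halves ε

end kernelOp


/-- For a fragmentation kernel `b` and a rate `φ > 0` bounded on bounded
subsets of `(0,∞)`, the operators `T_λ u(x) = ∫_x^∞ b(x,y) (φ(y)/(λ+φ(y))) u(y) dy`
satisfy `‖T_λⁿ u‖ → 0` in `L¹((0,∞), x dx)` for every `λ > 0` and every `u ∈ L¹`
(equivalently, the minimal semigroup for the pure fragmentation equation is stochastic). -/
theorem pure_fragmentation_stochastic
    (b : ℝ → ℝ → ℝ)
    (hb_meas : Measurable (Function.uncurry b))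
    (hb_nonneg : ∀ x y : ℝ, 0 ≤ b x y)
    (hb_supp : ∀ x y : ℝ, y ≤ x → b x y = 0)
    (hb_mass : ∀ y : ℝ, 0 < y → ∫ x in Ioi (0 : ℝ), b x y * x = y)
    (φ : ℝ → ℝ)
    (hφ_meas : Measurable φ)
    (hφ_pos : ∀ x : ℝ, 0 < x → 0 < φ x)
    (hφ_bdd : ∀ N : ℝ, 0 < N → ∃ M : ℝ, ∀ x : ℝ, 0 < x → x ≤ N → φ x ≤ M)
    (T : ℝ → (ℝ → ℝ) → ℝ → ℝ)
    (hT : ∀ (l : ℝ) (u : ℝ → ℝ) (x : ℝ),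
      T l u x = ∫ y in Ioi x, b x y * (φ y / (l + φ y)) * u y) :
    ∀ l : ℝ, 0 < l → ∀ u : ℝ → ℝ, Measurable u →
      IntegrableOn (fun x => u x * x) (Ioi (0 : ℝ)) →
      Tendsto (fun n : ℕ => ∫ x in Ioi (0 : ℝ), |(T l)^[n] u x| * x) atTop (nhds 0) := by
  intro l hl u hu hint
  set K : ℝ → ℝ → ℝ≥0∞ := fun x y => ENNReal.ofReal (b x y) * ‖φ y / (l + φ y)‖ₑ with hKdef
  have hK : Measurable (Function.uncurry K) := by
    refine (ENNReal.measurable_ofReal.comp hb_meas).mul (Measurable.enorm ?_)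
    have hφ' : Measurable fun p : ℝ × ℝ => φ p.2 := hφ_meas.comp measurable_snd
    exact hφ'.div (measurable_const.add hφ')
  have hsupp (x y : ℝ) (hxy : y ≤ x) : K x y = 0 := by simp [hKdef, hb_supp x y hxy]
  have hKmass (y : ℝ) (hy : 0 < y) :
      massNorm (K · y) = ‖φ y / (l + φ y)‖ₑ * ENNReal.ofReal y := by
    have hbi : IntegrableOn (fun x => b x y * x) (Ioi 0) := by
      by_contra h
      exact hy.ne ((integral_undef h).symm.trans (hb_mass y hy))
    have hby : Measurable fun x => b x y := hb_meas.comp measurable_prodMk_right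
    have hm : ENNReal.ofReal y = ∫⁻ x in Ioi (0 : ℝ), ENNReal.ofReal (b x y * x) := by
      rw [← ofReal_integral_eq_lintegral_ofReal hbi, hb_mass y hy]
      filter_upwards [ae_restrict_mem measurableSet_Ioi] with x hx
      exact mul_nonneg (hb_nonneg x y) (le_of_lt hx)
    have hbm : Measurable fun x => b x y * x := hby.mul measurable_id
    rw [hm, ← lintegral_const_mul _ hbm.ennreal_ofReal]
    refine lintegral_congr fun x => ?_
    rw [ENNReal.ofReal_mul (hb_nonneg x y)]
    ring
  have hmass (y : ℝ) (hy : 0 < y) : massNorm (K · y) ≤ ENNReal.ofReal y := by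
    have hφy := hφ_pos y hy
    have h1 : ‖φ y / (l + φ y)‖ₑ ≤ 1 := by
      rw [Real.enorm_of_nonneg (by positivity), ENNReal.ofReal_le_one, div_le_one (by positivity)]
      linarith
    rw [hKmass y hy]
    exact mul_le_of_le_one_left' h1
  have hcontr (N : ℝ) (hN : 0 < N) : ∃ q < (1 : ℝ≥0∞), ∀ y, 0 < y → y ≤ N →
      massNorm (K · y) ≤ q * ENNReal.ofReal y := by
    obtain ⟨M, hM⟩ := hφ_bdd N hN
    have hM0 : 0 < M := (hφ_pos N hN).trans_le (hM N hN le_rfl)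
    refine ⟨ENNReal.ofReal (M / (l + M)), ?_, fun y hy hyN => ?_⟩
    · rw [ENNReal.ofReal_lt_one, div_lt_one (by positivity)]
      linarith
    · have hφy := hφ_pos y hy
      rw [hKmass y hy, Real.enorm_of_nonneg (by positivity)]
      gcongr ENNReal.ofReal ?_ * _
      rw [div_le_div_iff₀ (by positivity) (by positivity)]
      nlinarith [hM y hy hyN]
  have hnorm (g : ℝ → ℝ) :
      ∫⁻ x in Ioi (0 : ℝ), ‖g x * x‖ₑ = massNorm fun x => ‖g x‖ₑ := by
    refine setLIntegral_congr_fun measurableSet_Ioi fun x hx => ?_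
    simp only [enorm_mul, Real.enorm_of_nonneg (le_of_lt (mem_Ioi.1 hx))]
  have hfin : massNorm (fun x => ‖u x‖ₑ) ≠ ∞ := by
    rw [← hnorm u]
    exact hint.2.ne
  have hdom (n : ℕ) : ∀ x, ‖(T l)^[n] u x‖ₑ ≤ (kernelOp K)^[n] (fun x => ‖u x‖ₑ) x := by
    induction n with
    | zero => exact fun x => le_rfl
    | succ n ih =>
      intro x
      simp only [Function.iterate_succ_apply']
      rw [hT]
      refine (enorm_integral_le_lintegral_enorm _).trans
        ((setLIntegral_le_lintegral _ _).trans (lintegral_mono fun y => ?_))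
      simp only [hKdef, enorm_mul, Real.enorm_of_nonneg (hb_nonneg x y)]
      gcongr
      exact ih y
  have hlim := tendsto_massNorm_kernelOp_iterate hK hsupp hmass hcontr hu.enorm hfin
  rw [tendsto_zero_iff_enorm_tendsto_zero]
  refine tendsto_of_tendsto_of_tendsto_of_le_of_le tendsto_const_nhds hlim
    (fun _ => zero_le) fun n => ?_
  refine (enorm_integral_le_lintegral_enorm _).trans ?_
  rw [hnorm fun x => |(T l)^[n] u x|]
  refine lintegral_mono fun x => ?_
  simp only [Real.enorm_abs]
  gcongr
  exact hdom n x
end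

section
/- Under the stated hypotheses: (a) lim_{x→∞} x^γ e^{−Q(x)} = 0; (b) for every y > 0, ∫₀^∞ x^γ k(x,y) x dx = (∫₀^1 z^{γ+1} h(z) dz) · ( y^γ + γ e^{Q(y)} ∫_y^∞ z^{γ−1} e^{−Q(z)} dz ), all integrals being finite; and (c) there exist constants 0 ≤ c < 1 and d ≥ 0, with c = ∫₀^1 z^{γ+1} h(z) dz, such that ∫₀^∞ x^γ k(x,y) x dx ≤ c y^γ + d for all y > 0. -/
open MeasureTheory Filter Set

theorem AbsolutelyContinuousOnInterval.comp_lipschitzOnWith {f u : ℝ → ℝ} {a b : ℝ} {K : NNReal}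
    {s : Set ℝ} (hf : AbsolutelyContinuousOnInterval f a b) (hu : LipschitzOnWith K u s)
    (hfs : MapsTo f (uIcc a b) s) : AbsolutelyContinuousOnInterval (fun x => u (f x)) a b := by
  have hK : Tendsto (fun E : ℕ × (ℕ → ℝ × ℝ) =>
      (K : ℝ) * ∑ i ∈ Finset.range E.1, dist (f (E.2 i).1) (f (E.2 i).2))
      (totalLengthFilter ⊓ 𝓟 (disjWithin a b)) (nhds 0) := by
    simpa using Tendsto.const_mul (K : ℝ) hf
  refine squeeze_zero' (Eventually.of_forall fun E => Finset.sum_nonneg fun _ _ => dist_nonneg)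
    ?_ hK
  filter_upwards [mem_inf_of_right (mem_principal_self _)] with E hE
  rw [Finset.mul_sum]
  exact Finset.sum_le_sum fun i hi =>
    hu.dist_le_mul _ (hfs (hE.1 i hi).1) _ (hfs (hE.1 i hi).2)

theorem lipschitzOnWith_exp_neg_Ici : LipschitzOnWith 1 (fun x : ℝ => Real.exp (-x)) (Ici 0) := by
  refine (convex_Ici 0).lipschitzOnWith_of_nnnorm_hasDerivWithin_le
    (f' := fun x => -Real.exp (-x)) (fun x _ => ?_) fun x hx => ?_
  · simpa using ((hasDerivAt_id x).neg.exp).hasDerivWithinAt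
  · rw [← NNReal.coe_le_coe]
    simpa using hx

section
variable {f : ℝ → ℝ}

theorem integrableOn_Ioo_of_locallyIntegrableOn_Ioi
    (hloc : LocallyIntegrableOn f (Ioi (0 : ℝ))) (hzero : IntegrableOn f (Ioo (0 : ℝ) 1)) (R : ℝ) :
    IntegrableOn f (Ioo 0 R) := by
  have h1 : IntegrableOn f (Icc (1 / 2) R) :=
    hloc.integrableOn_compact_subset (fun x hx => lt_of_lt_of_le (by norm_num) hx.1) isCompact_Icc
  refine (hzero.union h1).mono_set fun x hx => ?_
  rcases lt_or_ge x 1 with h | h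
  · exact Or.inl ⟨hx.1, h⟩
  · exact Or.inr ⟨by linarith, hx.2.le⟩

theorem monotone_integral_Ioo (hf : ∀ R, IntegrableOn f (Ioo 0 R)) (hf0 : ∀ x, 0 < x → 0 ≤ f x) :
    Monotone fun x => ∫ z in Ioo 0 x, f z := fun _ b hab =>
  setIntegral_mono_set (hf b) ((ae_restrict_iff' measurableSet_Ioo).2
    (Eventually.of_forall fun x hx => hf0 x hx.1)) (Ioo_subset_Ioo_right hab).eventuallyLE

theorem integral_Ioo_nonneg (hf0 : ∀ x, 0 < x → 0 ≤ f x) (x : ℝ) : 0 ≤ ∫ z in Ioo 0 x, f z :=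
  setIntegral_nonneg measurableSet_Ioo fun z hz => hf0 z hz.1

theorem intervalIntegrable_of_integrableOn_Ioo (hf : ∀ R, IntegrableOn f (Ioo 0 R)) {a b : ℝ}
    (ha : 0 ≤ a) (hb : 0 ≤ b) : IntervalIntegrable f volume a b :=
  intervalIntegrable_iff.2 ((hf (max a b + 1)).mono_set fun x hx => by
    rw [uIoc, mem_Ioc] at hx
    exact ⟨(le_min ha hb).trans_lt hx.1, by linarith [hx.2]⟩)

theorem integral_Ioo_eq_add_intervalIntegral (hf : ∀ R, IntegrableOn f (Ioo 0 R)) {a b : ℝ}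
    (ha : 0 ≤ a) (hb : 0 ≤ b) :
    ∫ z in Ioo 0 b, f z = (∫ z in Ioo 0 a, f z) + ∫ z in a..b, f z := by
  rw [← integral_Ioc_eq_integral_Ioo, ← integral_Ioc_eq_integral_Ioo,
    ← intervalIntegral.integral_of_le ha, ← intervalIntegral.integral_of_le hb,
    intervalIntegral.integral_add_adjacent_intervals
      (intervalIntegrable_of_integrableOn_Ioo hf le_rfl ha)
      (intervalIntegrable_of_integrableOn_Ioo hf ha hb)]

theorem absolutelyContinuousOnInterval_exp_neg (hf : ∀ R, IntegrableOn f (Ioo 0 R))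
    (hf0 : ∀ x, 0 < x → 0 ≤ f x) {Q : ℝ → ℝ} (hQ : ∀ x, Q x = ∫ z in Ioo 0 x, f z) {a b : ℝ}
    (ha : 0 ≤ a) (hb : 0 ≤ b) :
    AbsolutelyContinuousOnInterval (fun x => Real.exp (-Q x)) a b := by
  have h1 := (intervalIntegrable_of_integrableOn_Ioo hf le_rfl
    (le_max_of_le_left ha : 0 ≤ max a b)).absolutelyContinuousOnInterval_intervalIntegral
      (c := 0) (by simp)
  have hsub : uIcc a b ⊆ uIcc 0 (max a b) := by
    rw [uIcc_of_le (le_max_of_le_left ha : 0 ≤ max a b)]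
    exact Icc_subset_Icc (le_min ha hb) le_rfl
  have hpos : ∀ x ∈ uIcc a b, 0 ≤ x := fun x hx => (le_min ha hb).trans hx.1
  have hQ' : ∀ x ∈ uIcc a b, Q x = ∫ z in (0 : ℝ)..x, f z := fun x hx => by
    rw [hQ, integral_Ioo_eq_add_intervalIntegral hf le_rfl (hpos x hx)]
    simp
  have h2 := (h1.mono hsub).comp_lipschitzOnWith lipschitzOnWith_exp_neg_Ici fun x hx => by
    change 0 ≤ ∫ z in (0 : ℝ)..x, f z
    rw [← hQ' x hx, hQ]
    exact integral_Ioo_nonneg hf0 x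
  rw [absolutelyContinuousOnInterval_iff] at h2 ⊢
  intro ε hε
  obtain ⟨δ, hδ, H⟩ := h2 ε hε
  refine ⟨δ, hδ, fun E hE hEδ => ?_⟩
  convert H E hE hEδ using 2 with i hi
  rw [hQ' _ (hE.1 i hi).1, hQ' _ (hE.1 i hi).2]

theorem ae_deriv_exp_neg (hf : ∀ R, IntegrableOn f (Ioo 0 R)) {Q : ℝ → ℝ}
    (hQ : ∀ x, Q x = ∫ z in Ioo 0 x, f z) {a b : ℝ} (ha : 0 < a) (hab : a ≤ b) :
    ∀ᵐ x, x ∈ uIoc a b → deriv (fun x => Real.exp (-Q x)) x = -(f x * Real.exp (-Q x)) := by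
  filter_upwards [(intervalIntegrable_of_integrableOn_Ioo hf le_rfl
    (ha.le.trans hab)).ae_hasDerivAt_integral] with x hx hxab
  rw [uIoc_of_le hab] at hxab
  have hx0 : 0 < x := ha.trans hxab.1
  have h1 := hx (by rw [uIcc_of_le (ha.le.trans hab)]; exact ⟨hx0.le, hxab.2⟩) 0 (by simp)
  have h2 : HasDerivAt Q (f x) x := by
    refine h1.congr_of_eventuallyEq ?_
    filter_upwards [lt_mem_nhds hx0] with t ht
    rw [hQ, integral_Ioo_eq_add_intervalIntegral hf le_rfl ht.le]
    simp
  rw [h2.fun_neg.exp.deriv]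
  ring

theorem intervalIntegrable_mul_exp_neg (hf : ∀ R, IntegrableOn f (Ioo 0 R))
    (hf0 : ∀ x, 0 < x → 0 ≤ f x) {Q : ℝ → ℝ} (hQ : ∀ x, Q x = ∫ z in Ioo 0 x, f z) {a b s : ℝ}
    (ha : 0 < a) (hb : 0 < b) :
    IntervalIntegrable (fun x => x ^ s * (f x * Real.exp (-Q x))) volume a b := by
  refine ((intervalIntegrable_of_integrableOn_Ioo hf ha.le hb.le).mul_continuousOn
    (absolutelyContinuousOnInterval_exp_neg hf hf0 hQ ha.le hb.le).continuousOn).continuousOn_mul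
    fun x hx => (Real.continuousAt_rpow_const x s (Or.inl ?_)).continuousWithinAt
  exact ((lt_min ha hb).trans_le hx.1).ne'

theorem integral_rpow_mul_exp_neg (hf : ∀ R, IntegrableOn f (Ioo 0 R))
    (hf0 : ∀ x, 0 < x → 0 ≤ f x) {Q : ℝ → ℝ} (hQ : ∀ x, Q x = ∫ z in Ioo 0 x, f z) {a b s : ℝ}
    (ha : 0 < a) (hab : a ≤ b) :
    ∫ x in a..b, x ^ s * (f x * Real.exp (-Q x)) =
      a ^ s * Real.exp (-Q a) - b ^ s * Real.exp (-Q b) +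
        s * ∫ x in a..b, x ^ (s - 1) * Real.exp (-Q x) := by
  have hne : ∀ x ∈ uIcc a b, x ≠ 0 := fun x hx => by
    rw [uIcc_of_le hab] at hx
    exact (ha.trans_le hx.1).ne'
  have hac : AbsolutelyContinuousOnInterval (fun x : ℝ => x ^ s) a b :=
    ContDiffOn.absolutelyContinuousOnInterval fun x hx =>
      (Real.contDiffAt_rpow_const_of_ne (hne x hx)).contDiffWithinAt
  have hibp := hac.integral_mul_deriv_eq_deriv_mul
    (absolutelyContinuousOnInterval_exp_neg hf hf0 hQ ha.le (ha.le.trans hab))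
  have h1 : ∫ x in a..b, x ^ s * deriv (fun x => Real.exp (-Q x)) x =
      -∫ x in a..b, x ^ s * (f x * Real.exp (-Q x)) := by
    rw [← intervalIntegral.integral_neg]
    refine intervalIntegral.integral_congr_ae ?_
    filter_upwards [ae_deriv_exp_neg hf hQ ha hab] with x hx hxab
    rw [hx hxab]
    ring
  have h2 : ∫ x in a..b, deriv (fun x : ℝ => x ^ s) x * Real.exp (-Q x) =
      s * ∫ x in a..b, x ^ (s - 1) * Real.exp (-Q x) := by
    rw [← intervalIntegral.integral_const_mul]
    refine intervalIntegral.integral_congr fun x hx => ?_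
    rw [Real.deriv_rpow_const]
    ring
  rw [h1, h2] at hibp
  linarith
theorem mul_exp_neg_integral_le (hf : ∀ R, IntegrableOn f (Ioo 0 R))
    (hf0 : ∀ x, 0 < x → 0 ≤ f x) {Q : ℝ → ℝ} (hQ : ∀ x, Q x = ∫ z in Ioo 0 x, f z) {a b : ℝ}
    (ha : 0 < a) (hab : a ≤ b) :
    ∫ x in a..b, f x * Real.exp (-Q x) ≤ Real.exp (-Q a) := by
  have h := integral_rpow_mul_exp_neg hf hf0 hQ (s := 0) ha hab
  simp only [Real.rpow_zero, one_mul, zero_mul, add_zero] at h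
  linarith [Real.exp_pos (-Q b)]

theorem intervalIntegrable_rpow_mul_exp_neg (hf : ∀ R, IntegrableOn f (Ioo 0 R))
    (hf0 : ∀ x, 0 < x → 0 ≤ f x) {Q : ℝ → ℝ} (hQ : ∀ x, Q x = ∫ z in Ioo 0 x, f z) {a b s : ℝ}
    (ha : 0 < a) (hb : 0 < b) :
    IntervalIntegrable (fun x => x ^ s * Real.exp (-Q x)) volume a b := by
  refine ContinuousOn.intervalIntegrable (ContinuousOn.mul (fun x hx =>
    (Real.continuousAt_rpow_const x s (Or.inl ?_)).continuousWithinAt)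
    (absolutelyContinuousOnInterval_exp_neg hf hf0 hQ ha.le hb.le).continuousOn)
  exact ((lt_min ha hb).trans_le hx.1).ne'

theorem tendsto_rpow_mul_exp_neg (hf : ∀ R, IntegrableOn f (Ioo 0 R))
    (hf0 : ∀ x, 0 < x → 0 ≤ f x) {Q : ℝ → ℝ} (hQ : ∀ x, Q x = ∫ z in Ioo 0 x, f z) {γ c R : ℝ}
    (hγ : 0 < γ) (hc : 0 < c) (hR : 0 < R) (hfR : ∀ x, R ≤ x → c * x ^ (γ - 1) ≤ f x) :
    Tendsto (fun x : ℝ => x ^ γ * Real.exp (-Q x)) atTop (nhds 0) := by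
  have hlow : ∀ x, R ≤ x → c / γ * (x ^ γ - R ^ γ) ≤ Q x := fun x hx => by
    have hx0 := hR.trans_le hx
    have h1 : ∫ z in R..x, c * z ^ (γ - 1) ≤ ∫ z in R..x, f z :=
      intervalIntegral.integral_mono_on hx
        ((intervalIntegral.intervalIntegrable_rpow' (by linarith)).const_mul c)
        (intervalIntegrable_of_integrableOn_Ioo hf hR.le hx0.le) fun z hz => hfR z hz.1
    rw [intervalIntegral.integral_const_mul, integral_rpow (Or.inl (by linarith)),
      sub_add_cancel] at h1
    rw [hQ, integral_Ioo_eq_add_intervalIntegral hf hR.le hx0.le]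
    calc c / γ * (x ^ γ - R ^ γ) = c * ((x ^ γ - R ^ γ) / γ) := by ring
      _ ≤ _ := by linarith [integral_Ioo_nonneg hf0 R]
  have hlim : Tendsto (fun x : ℝ =>
      Real.exp (c / γ * R ^ γ) * ((x ^ γ) ^ (1 : ℝ) * Real.exp (-(c / γ) * x ^ γ)))
      atTop (nhds 0) := by
    simpa using ((tendsto_rpow_mul_exp_neg_mul_atTop_nhds_zero 1 (c / γ)
      (div_pos hc hγ)).comp (tendsto_rpow_atTop hγ)).const_mul (Real.exp (c / γ * R ^ γ))
  refine squeeze_zero' ?_ ?_ hlim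
  · filter_upwards [eventually_ge_atTop 0] with x hx
    positivity
  · filter_upwards [eventually_ge_atTop R] with x hx
    have hx0 := hR.trans_le hx
    rw [Real.rpow_one, mul_left_comm, ← Real.exp_add]
    gcongr
    linarith [hlow x hx]

theorem integrableOn_rpow_mul_exp_neg_Ioi (hf : ∀ R, IntegrableOn f (Ioo 0 R))
    (hf0 : ∀ x, 0 < x → 0 ≤ f x) {Q : ℝ → ℝ} (hQ : ∀ x, Q x = ∫ z in Ioo 0 x, f z) {γ c R a : ℝ}
    (hc : 0 < c) (hR : 0 < R) (hfR : ∀ x, R ≤ x → c * x ^ (γ - 1) ≤ f x)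
    (ha : R ≤ a) :
    IntegrableOn (fun x => x ^ (γ - 1) * Real.exp (-Q x)) (Ioi a) ∧
      ∫ x in Ioi a, x ^ (γ - 1) * Real.exp (-Q x) ≤ Real.exp (-Q a) / c := by
  have ha0 := hR.trans_le ha
  have hb : ∀ b, a ≤ b →
      ∫ x in a..b, x ^ (γ - 1) * Real.exp (-Q x) ≤ Real.exp (-Q a) / c := fun b hab => by
    rw [le_div_iff₀ hc, mul_comm, ← intervalIntegral.integral_const_mul]
    refine le_trans (intervalIntegral.integral_mono_on hab
      ((intervalIntegrable_rpow_mul_exp_neg hf hf0 hQ ha0 (ha0.trans_le hab)).const_mul c)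
      (by simpa using intervalIntegrable_mul_exp_neg hf hf0 hQ (s := 0) ha0 (ha0.trans_le hab))
      fun x hx => ?_) (mul_exp_neg_integral_le hf hf0 hQ ha0 hab)
    rw [← mul_assoc]
    gcongr
    exact hfR x (ha.trans hx.1)
  have hint : IntegrableOn (fun x => x ^ (γ - 1) * Real.exp (-Q x)) (Ioi a) := by
    refine integrableOn_Ioi_of_intervalIntegral_norm_bounded (Real.exp (-Q a) / c) a
      (b := fun b => max a b) (l := atTop) (fun b => ?_)
      (tendsto_atTop_mono (fun b => le_max_right a b) tendsto_id)
      (Eventually.of_forall fun b => ?_)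
    · exact (intervalIntegrable_iff_integrableOn_Ioc_of_le (le_max_left a b)).1
        (intervalIntegrable_rpow_mul_exp_neg hf hf0 hQ ha0 (ha0.trans_le (le_max_left a b)))
    · refine le_of_eq_of_le (intervalIntegral.integral_congr fun x hx => ?_)
        (hb _ (le_max_left a b))
      rw [uIcc_of_le (le_max_left a b)] at hx
      have hx0 : 0 < x := ha0.trans_le hx.1
      exact Real.norm_of_nonneg (by positivity)
  refine ⟨hint, le_of_tendsto (intervalIntegral_tendsto_integral_Ioi a hint tendsto_id) ?_⟩
  filter_upwards [eventually_ge_atTop a] with b hab using hb b hab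

theorem exp_mul_integral_rpow_mul_exp_neg_Ioi_le (hf : ∀ R, IntegrableOn f (Ioo 0 R))
    (hf0 : ∀ x, 0 < x → 0 ≤ f x) {Q : ℝ → ℝ} (hQ : ∀ x, Q x = ∫ z in Ioo 0 x, f z) {γ c R y : ℝ}
    (hγ : 0 < γ) (hc : 0 < c) (hR : 0 < R) (hfR : ∀ x, R ≤ x → c * x ^ (γ - 1) ≤ f x)
    (hy : 0 < y) :
    IntegrableOn (fun x => x ^ (γ - 1) * Real.exp (-Q x)) (Ioi y) ∧
      Real.exp (Q y) * ∫ x in Ioi y, x ^ (γ - 1) * Real.exp (-Q x) ≤ R ^ γ / γ + 1 / c := by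
  have hexp : ∀ {z}, Q y ≤ Q z → Real.exp (Q y) * Real.exp (-Q z) ≤ 1 := fun {z} hz => by
    rw [← Real.exp_add]
    exact Real.exp_le_one_iff.2 (by linarith)
  rcases le_total R y with h | h
  · obtain ⟨h1, h2⟩ := integrableOn_rpow_mul_exp_neg_Ioi hf hf0 hQ hc hR hfR h
    refine ⟨h1, ?_⟩
    calc Real.exp (Q y) * ∫ x in Ioi y, x ^ (γ - 1) * Real.exp (-Q x)
        ≤ Real.exp (Q y) * (Real.exp (-Q y) / c) := by gcongr
      _ = Real.exp (Q y) * Real.exp (-Q y) / c := by ring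
      _ ≤ 1 / c := by gcongr; exact hexp le_rfl
      _ ≤ _ := by linarith [div_pos (Real.rpow_pos_of_pos hR γ) hγ]
  · obtain ⟨h1, h2⟩ := integrableOn_rpow_mul_exp_neg_Ioi hf hf0 hQ hc hR hfR (le_refl R)
    have hmono : Monotone Q := by
      rw [funext hQ]
      exact monotone_integral_Ioo hf hf0
    have hyR := intervalIntegrable_rpow_mul_exp_neg (s := γ - 1) hf hf0 hQ hy hR
    have hint : IntegrableOn (fun x => x ^ (γ - 1) * Real.exp (-Q x)) (Ioi y) := by
      rw [← Ioc_union_Ioi_eq_Ioi h]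
      exact ((intervalIntegrable_iff_integrableOn_Ioc_of_le h).1 hyR).union h1
    refine ⟨hint, ?_⟩
    rw [← intervalIntegral.integral_interval_add_Ioi hint h1, mul_add]
    refine add_le_add ?_ ?_
    · rw [← intervalIntegral.integral_const_mul]
      calc ∫ x in y..R, Real.exp (Q y) * (x ^ (γ - 1) * Real.exp (-Q x))
          ≤ ∫ x in y..R, x ^ (γ - 1) := by
            refine intervalIntegral.integral_mono_on h (hyR.const_mul _)
              (intervalIntegral.intervalIntegrable_rpow' (by linarith)) fun x hx => ?_
            rw [mul_left_comm]
            exact mul_le_of_le_one_right (Real.rpow_nonneg (hy.le.trans hx.1) _)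
              (hexp (hmono hx.1))
        _ = (R ^ γ - y ^ γ) / γ := by
            rw [integral_rpow (Or.inl (by linarith)), sub_add_cancel]
        _ ≤ R ^ γ / γ := by
            gcongr
            linarith [Real.rpow_nonneg hy.le γ]
    · calc Real.exp (Q y) * ∫ x in Ioi R, x ^ (γ - 1) * Real.exp (-Q x)
          ≤ Real.exp (Q y) * (Real.exp (-Q R) / c) := by gcongr
        _ = Real.exp (Q y) * Real.exp (-Q R) / c := by ring
        _ ≤ 1 / c := by gcongr; exact hexp (hmono h)

theorem integral_rpow_mul_exp_neg_Ioi (hf : ∀ R, IntegrableOn f (Ioo 0 R))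
    (hf0 : ∀ x, 0 < x → 0 ≤ f x) {Q : ℝ → ℝ} (hQ : ∀ x, Q x = ∫ z in Ioo 0 x, f z) {γ y : ℝ}
    (hlim : Tendsto (fun x : ℝ => x ^ γ * Real.exp (-Q x)) atTop (nhds 0)) (hy : 0 < y)
    (hint : IntegrableOn (fun x => x ^ (γ - 1) * Real.exp (-Q x)) (Ioi y)) :
    IntegrableOn (fun x => x ^ γ * (f x * Real.exp (-Q x))) (Ioi y) ∧
      ∫ x in Ioi y, x ^ γ * (f x * Real.exp (-Q x)) =
        y ^ γ * Real.exp (-Q y) + γ * ∫ x in Ioi y, x ^ (γ - 1) * Real.exp (-Q x) := by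
  have ht : Tendsto (fun b => ∫ x in y..b, x ^ γ * (f x * Real.exp (-Q x))) atTop
      (nhds (y ^ γ * Real.exp (-Q y) +
        γ * ∫ x in Ioi y, x ^ (γ - 1) * Real.exp (-Q x))) := by
    have h1 := ((tendsto_const_nhds (x := y ^ γ * Real.exp (-Q y))).sub hlim).add
      ((intervalIntegral_tendsto_integral_Ioi y hint tendsto_id).const_mul γ)
    rw [sub_zero] at h1
    refine h1.congr' ?_
    filter_upwards [eventually_ge_atTop y] with b hb
    exact (integral_rpow_mul_exp_neg hf hf0 hQ hy hb).symm
  have hI : IntegrableOn (fun x => x ^ γ * (f x * Real.exp (-Q x))) (Ioi y) := by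
    refine integrableOn_Ioi_of_intervalIntegral_norm_tendsto _ y
      (b := fun b => max y b) (l := atTop) (fun b => ?_)
      (tendsto_atTop_mono (fun b => le_max_right y b) tendsto_id) (ht.congr' ?_)
    · exact (intervalIntegrable_iff_integrableOn_Ioc_of_le (le_max_left y b)).1
        (intervalIntegrable_mul_exp_neg hf hf0 hQ hy (hy.trans_le (le_max_left y b)))
    · filter_upwards [eventually_ge_atTop y] with b hb
      rw [max_eq_right hb]
      refine intervalIntegral.integral_congr fun x hx => ?_
      rw [uIcc_of_le hb] at hx
      have hx0 : 0 < x := hy.trans_le hx.1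
      have := hf0 x hx0
      exact (Real.norm_of_nonneg (by positivity)).symm
  exact ⟨hI, tendsto_nhds_unique (intervalIntegral_tendsto_integral_Ioi y hI tendsto_id) ht⟩
end

section
variable {h : ℝ → ℝ}

theorem integrableOn_rpow_mul_of_integrableOn_mul {γ : ℝ} (hγ : 0 < γ) (hh_meas : Measurable h)
    (hh_int : IntegrableOn (fun z => h z * z) (Ioo (0 : ℝ) 1)) :
    IntegrableOn (fun z => z ^ (γ + 1) * h z) (Ioo (0 : ℝ) 1) := by
  refine Integrable.mono hh_int (by fun_prop) ((ae_restrict_iff' measurableSet_Ioo).2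
    (Eventually.of_forall fun z hz => ?_))
  rw [Real.rpow_add_one hz.1.ne', mul_assoc, norm_mul, mul_comm z,
    Real.norm_of_nonneg (Real.rpow_nonneg hz.1.le _)]
  exact mul_le_of_le_one_left (norm_nonneg _) (Real.rpow_le_one hz.1.le hz.2.le hγ.le)

theorem integral_rpow_mul_lt_one {γ : ℝ} (hγ : 0 < γ) (hh_meas : Measurable h)
    (hh_nonneg : ∀ z : ℝ, 0 < z → z < 1 → 0 ≤ h z)
    (hh_int : IntegrableOn (fun z => h z * z) (Ioo (0 : ℝ) 1))
    (hh_mass : ∫ z in Ioo (0 : ℝ) 1, h z * z = 1)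
    (hh_ne : ¬ (∀ᵐ z ∂(volume.restrict (Ioo (0 : ℝ) 1)), h z = 0)) :
    ∫ z in Ioo (0 : ℝ) 1, z ^ (γ + 1) * h z < 1 := by
  have hint := integrableOn_rpow_mul_of_integrableOn_mul hγ hh_meas hh_int
  have heq : ∀ z ∈ Ioo (0 : ℝ) 1, h z * z - z ^ (γ + 1) * h z = h z * z * (1 - z ^ γ) :=
    fun z hz => by
      rw [Real.rpow_add_one hz.1.ne']
      ring
  have hnn : ∀ z ∈ Ioo (0 : ℝ) 1, 0 ≤ h z * z - z ^ (γ + 1) * h z := fun z hz => by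
    rw [heq z hz]
    exact mul_nonneg (mul_nonneg (hh_nonneg z hz.1 hz.2) hz.1.le)
      (sub_nonneg.2 (Real.rpow_le_one hz.1.le hz.2.le hγ.le))
  have h0 : 0 ≤ ∫ z in Ioo (0 : ℝ) 1, (h z * z - z ^ (γ + 1) * h z) :=
    setIntegral_nonneg measurableSet_Ioo hnn
  have h1 : ∫ z in Ioo (0 : ℝ) 1, (h z * z - z ^ (γ + 1) * h z) ≠ 0 := fun h2 => by
    rw [setIntegral_eq_zero_iff_of_nonneg_ae ((ae_restrict_iff' measurableSet_Ioo).2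
      (Eventually.of_forall hnn)) (hh_int.sub hint)] at h2
    refine hh_ne ?_
    filter_upwards [h2, ae_restrict_mem measurableSet_Ioo] with z hz hzm
    rw [heq z hzm] at hz
    have h3 : 1 - z ^ γ ≠ 0 := (sub_pos.2 (Real.rpow_lt_one hzm.1.le hzm.2 hγ)).ne'
    simpa [h3, hzm.1.ne'] using hz
  rw [integral_sub hh_int hint, hh_mass] at h0 h1
  exact lt_of_le_of_ne (by linarith) fun h2 => h1 (by linarith)

theorem integral_rpow_mul_homogeneous_kernel {γ z : ℝ} {b : ℝ → ℝ → ℝ}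
    (hb : ∀ x y : ℝ, b x y = if 0 < x ∧ x < y then y⁻¹ * h (x / y) else 0)
    (hint : IntegrableOn (fun z => z ^ (γ + 1) * h z) (Ioo (0 : ℝ) 1)) (hz : 0 < z) :
    IntegrableOn (fun x => x ^ (γ + 1) * b x z) (Ioi (0 : ℝ)) ∧
      ∫ x in Ioi (0 : ℝ), x ^ (γ + 1) * b x z =
        z ^ (γ + 1) * ∫ u in Ioo (0 : ℝ) 1, u ^ (γ + 1) * h u := by
  set H : ℝ → ℝ := (Ioo (0 : ℝ) 1).indicator fun u => u ^ (γ + 1) * h u with hH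
  have heq : EqOn (fun x => z ^ γ * H (z⁻¹ * x)) (fun x => x ^ (γ + 1) * b x z) (Ioi 0) := by
    intro x hx
    have hx0 : 0 < x := hx
    have hiff : z⁻¹ * x ∈ Ioo (0 : ℝ) 1 ↔ 0 < x ∧ x < z := by
      rw [mem_Ioo, inv_mul_lt_one₀ hz]
      simp [hz, hx0]
    simp only [hH, indicator_apply, hb, hiff]
    split_ifs with hxz
    · rw [Real.mul_rpow (inv_pos.2 hz).le hx0.le, Real.inv_rpow hz.le, Real.rpow_add_one hz.ne',
        inv_mul_eq_div]
      have := (Real.rpow_pos_of_pos hz γ).ne'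
      field_simp
    · simp
  have hHint : IntegrableOn H (Ioi 0) :=
    ((integrable_indicator_iff measurableSet_Ioo).2 hint).integrableOn
  have hHval : ∫ u in Ioi (0 : ℝ), H u = ∫ u in Ioo (0 : ℝ) 1, u ^ (γ + 1) * h u := by
    rw [hH, setIntegral_indicator measurableSet_Ioo,
      inter_eq_self_of_subset_right Ioo_subset_Ioi_self]
  constructor
  · refine IntegrableOn.congr_fun ?_ heq measurableSet_Ioi
    refine Integrable.const_mul ?_ _
    refine (integrableOn_Ioi_comp_mul_left_iff H 0 (inv_pos.2 hz)).2 ?_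
    rwa [mul_zero]
  · rw [← setIntegral_congr_fun measurableSet_Ioi heq, integral_const_mul,
      integral_comp_mul_left_Ioi H 0 (inv_pos.2 hz), mul_zero, hHval, inv_inv, smul_eq_mul,
      Real.rpow_add_one hz.ne', mul_assoc]

theorem integral_rpow_mul_fragmentation_kernel {γ y : ℝ} {b : ℝ → ℝ → ℝ} {f Q : ℝ → ℝ}
    {κ : ℝ → ℝ} (hh_meas : Measurable h)
    (hh_nonneg : ∀ z : ℝ, 0 < z → z < 1 → 0 ≤ h z)
    (hb : ∀ x y : ℝ, b x y = if 0 < x ∧ x < y then y⁻¹ * h (x / y) else 0)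
    (hint : IntegrableOn (fun z => z ^ (γ + 1) * h z) (Ioo (0 : ℝ) 1))
    (hf : ∀ R, IntegrableOn f (Ioo 0 R)) (hf0 : ∀ x, 0 < x → 0 ≤ f x)
    (hQ : Monotone Q) (hy : 0 < y)
    (hfint : IntegrableOn (fun x => x ^ γ * (f x * Real.exp (-Q x))) (Ioi y))
    (hκ : ∀ x, κ x = ∫ z in Ioi (max x y), b x z * (f z / z) * Real.exp (Q y - Q z)) :
    IntegrableOn (fun x => x ^ γ * κ x * x) (Ioi (0 : ℝ)) ∧
      ∫ x in Ioi (0 : ℝ), x ^ γ * κ x * x =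
        (∫ z in Ioo (0 : ℝ) 1, z ^ (γ + 1) * h z) *
          (Real.exp (Q y) * ∫ z in Ioi y, z ^ γ * (f z * Real.exp (-Q z))) := by
  set M := ∫ z in Ioo (0 : ℝ) 1, z ^ (γ + 1) * h z with hM
  set W : ℝ → ℝ := fun z => f z / z * Real.exp (Q y - Q z) with hW
  set G : ℝ × ℝ → ℝ := fun p => p.1 ^ (γ + 1) * b p.1 p.2 * W p.2 with hG
  have hbm : Measurable fun p : ℝ × ℝ => b p.1 p.2 := by
    simp only [hb]
    refine Measurable.ite ?_ (by fun_prop) measurable_const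
    exact (measurableSet_lt measurable_const measurable_fst).inter
      (measurableSet_lt measurable_fst measurable_snd)
  have hfm : AEStronglyMeasurable f (volume.restrict (Ioi y)) := by
    have h1 : AEStronglyMeasurable f (volume.restrict (⋃ n : ℕ, Ioo (0 : ℝ) n)) :=
      (aestronglyMeasurable_iUnion_iff).2 fun n => (hf n).aestronglyMeasurable
    refine h1.mono_set fun x hx => mem_iUnion.2 ?_
    obtain ⟨n, hn⟩ := exists_nat_gt x
    exact ⟨n, hy.trans hx, hn⟩
  have hWm : AEStronglyMeasurable W (volume.restrict (Ioi y)) := by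
    have hQm := hQ.measurable
    exact (AEMeasurable.mul (hfm.aemeasurable.div (by fun_prop)) (by fun_prop)).aestronglyMeasurable
  have hGm : AEStronglyMeasurable G
      ((volume.restrict (Ioi (0 : ℝ))).prod (volume.restrict (Ioi y))) :=
    (Measurable.aestronglyMeasurable (by fun_prop)).mul hWm.comp_snd
  have hinner : ∀ z ∈ Ioi y, ∫ x in Ioi (0 : ℝ), G (x, z) =
      M * (Real.exp (Q y) * (z ^ γ * (f z * Real.exp (-Q z)))) := fun z hz => by
    have hz0 : 0 < z := hy.trans hz
    simp only [hG, hW]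
    rw [integral_mul_const, (integral_rpow_mul_homogeneous_kernel hb hint hz0).2, sub_eq_add_neg,
      Real.exp_add, Real.rpow_add_one hz0.ne']
    field_simp
    ring
  have hGnn : ∀ z ∈ Ioi y, ∀ x ∈ Ioi (0 : ℝ), 0 ≤ G (x, z) := fun z hz x hx => by
    have hz0 : 0 < z := hy.trans hz
    have hx0 : 0 < x := hx
    have hbnn : 0 ≤ b x z := by
      rw [hb]
      split_ifs with hxz
      · exact mul_nonneg (inv_pos.2 hz0).le
          (hh_nonneg _ (div_pos hx0 hz0) ((div_lt_one hz0).2 hxz.2))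
      · exact le_rfl
    have := hf0 z hz0
    simp only [hG, hW]
    positivity
  have hrhs : IntegrableOn
      (fun z => M * (Real.exp (Q y) * (z ^ γ * (f z * Real.exp (-Q z))))) (Ioi y) :=
    (hfint.const_mul _).const_mul _
  have hGint : Integrable G
      ((volume.restrict (Ioi (0 : ℝ))).prod (volume.restrict (Ioi y))) := by
    rw [integrable_prod_iff' hGm]
    refine ⟨?_, IntegrableOn.congr_fun hrhs (fun z hz => ?_) measurableSet_Ioi⟩
    · filter_upwards [ae_restrict_mem measurableSet_Ioi] with z hz
      exact (integral_rpow_mul_homogeneous_kernel hb hint (hy.trans hz)).1.mul_const (W z)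
    · rw [← hinner z hz]
      exact setIntegral_congr_fun measurableSet_Ioi fun x hx =>
        (Real.norm_of_nonneg (hGnn z hz x hx)).symm
  have hκG : EqOn (fun x => ∫ z in Ioi y, G (x, z)) (fun x => x ^ γ * κ x * x) (Ioi 0) := by
    intro x hx
    have hx0 : 0 < x := hx
    have h1 : κ x = ∫ z in Ioi y, b x z * (f z / z) * Real.exp (Q y - Q z) := by
      rw [hκ]
      refine (setIntegral_eq_of_subset_of_forall_sdiff_eq_zero measurableSet_Ioi
        (Ioi_subset_Ioi (le_max_right x y)) fun z hz => ?_).symm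
      have hzx : ¬ (0 < x ∧ x < z) := fun h2 => hz.2 (max_lt h2.2 hz.1)
      simp [hb, hzx]
    simp only [h1]
    rw [mul_right_comm, ← Real.rpow_add_one hx0.ne', ← integral_const_mul]
    refine integral_congr_ae (Eventually.of_forall fun z => ?_)
    simp only [hG, hW]
    ring
  constructor
  · exact IntegrableOn.congr_fun hGint.integral_prod_left hκG measurableSet_Ioi
  · rw [← setIntegral_congr_fun measurableSet_Ioi hκG, integral_integral_swap hGint,
      setIntegral_congr_fun measurableSet_Ioi hinner, integral_const_mul, integral_const_mul]

end

/-- For fragmentation with growth with a homogeneous kernel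
`b(x,y) = y⁻¹ h(x/y)`, rate `φ`, growth `g`, and `Q(x) = ∫₀^x φ(z)/g(z) dz → ∞`, if
`liminf_{x→∞} φ(x)/(x^{γ−1} g(x)) > 0` for some `γ > 0`, then for
`k(x,y) = ∫_{max(x,y)}^∞ b(x,z) (φ(z)/(z g(z))) e^{Q(y)−Q(z)} dz`:
(a) `x^γ e^{−Q(x)} → 0` as `x → ∞`;
(b) for every `y > 0`,
`∫₀^∞ x^γ k(x,y) x dx = (∫₀^1 z^{γ+1} h(z) dz) (y^γ + γ e^{Q(y)} ∫_y^∞ z^{γ−1} e^{−Q(z)} dz)`,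
all integrals being finite; and
(c) with `c = ∫₀^1 z^{γ+1} h(z) dz` one has `0 ≤ c < 1` and there is `d ≥ 0` such that
`∫₀^∞ x^γ k(x,y) x dx ≤ c y^γ + d` for all `y > 0`  (so `V(x) = x^γ` is a Lyapunov
function for `K`). -/
theorem fragmentation_growth_lyapunov
    (g : ℝ → ℝ) (hg_cont : ContinuousOn g (Ioi (0 : ℝ)))
    (hg_pos : ∀ x : ℝ, 0 < x → 0 < g x)
    (φ : ℝ → ℝ) (hφ_meas : Measurable φ)
    (hφ_nonneg : ∀ x : ℝ, 0 < x → 0 ≤ φ x)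
    (hφg_loc : LocallyIntegrableOn (fun z => φ z / g z) (Ioi (0 : ℝ)))
    (hφg_zero : IntegrableOn (fun z => φ z / g z) (Ioo (0 : ℝ) 1))
    (Q : ℝ → ℝ) (hQ : ∀ x : ℝ, Q x = ∫ z in Ioo (0 : ℝ) x, φ z / g z)
    (hQ_top : Tendsto Q atTop atTop)
    (γ : ℝ) (hγ : 0 < γ)
    (hliminf : ∃ c : ℝ, 0 < c ∧ ∀ᶠ x in atTop, c ≤ φ x / (x ^ (γ - 1) * g x))
    (h : ℝ → ℝ) (hh_meas : Measurable h)
    (hh_nonneg : ∀ z : ℝ, 0 < z → z < 1 → 0 ≤ h z)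
    (hh_int : IntegrableOn (fun z => h z * z) (Ioo (0 : ℝ) 1))
    (hh_mass : ∫ z in Ioo (0 : ℝ) 1, h z * z = 1)
    (hh_ne : ¬ (∀ᵐ z ∂(volume.restrict (Ioo (0 : ℝ) 1)), h z = 0))
    (b : ℝ → ℝ → ℝ)
    (hb : ∀ x y : ℝ, b x y = if 0 < x ∧ x < y then y⁻¹ * h (x / y) else 0)
    (k : ℝ → ℝ → ℝ)
    (hk : ∀ x y : ℝ,
      k x y = ∫ z in Ioi (max x y), b x z * (φ z / (z * g z)) * Real.exp (Q y - Q z)) :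
    Tendsto (fun x : ℝ => x ^ γ * Real.exp (-Q x)) atTop (nhds 0) ∧
    (∀ y : ℝ, 0 < y →
      IntegrableOn (fun x => x ^ γ * k x y * x) (Ioi (0 : ℝ)) ∧
      IntegrableOn (fun z => z ^ (γ + 1) * h z) (Ioo (0 : ℝ) 1) ∧
      IntegrableOn (fun z => z ^ (γ - 1) * Real.exp (-Q z)) (Ioi y) ∧
      ∫ x in Ioi (0 : ℝ), x ^ γ * k x y * x =
        (∫ z in Ioo (0 : ℝ) 1, z ^ (γ + 1) * h z) *
          (y ^ γ + γ * Real.exp (Q y) * ∫ z in Ioi y, z ^ (γ - 1) * Real.exp (-Q z))) ∧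
    (∃ c d : ℝ, 0 ≤ c ∧ c < 1 ∧ 0 ≤ d ∧
      c = ∫ z in Ioo (0 : ℝ) 1, z ^ (γ + 1) * h z ∧
      ∀ y : ℝ, 0 < y → ∫ x in Ioi (0 : ℝ), x ^ γ * k x y * x ≤ c * y ^ γ + d) := by
  obtain ⟨c, hc, hev⟩ := hliminf
  obtain ⟨R₀, hR₀⟩ := eventually_atTop.1 hev
  have hR : 0 < max R₀ 1 := lt_max_of_lt_right one_pos
  have hf := integrableOn_Ioo_of_locallyIntegrableOn_Ioi hφg_loc hφg_zero
  have hf0 : ∀ x : ℝ, 0 < x → 0 ≤ φ x / g x := fun x hx =>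
    div_nonneg (hφ_nonneg x hx) (hg_pos x hx).le
  have hfR : ∀ x, max R₀ 1 ≤ x → c * x ^ (γ - 1) ≤ φ x / g x := fun x hx => by
    have hx0 := hR.trans_le hx
    have h1 := hR₀ x ((le_max_left _ _).trans hx)
    rwa [mul_comm (x ^ (γ - 1)), ← div_div, le_div_iff₀ (Real.rpow_pos_of_pos hx0 _)] at h1
  have hlim := tendsto_rpow_mul_exp_neg hf hf0 hQ hγ hc hR hfR
  have hmono : Monotone Q := by
    rw [funext hQ]
    exact monotone_integral_Ioo hf hf0
  have hint := integrableOn_rpow_mul_of_integrableOn_mul hγ hh_meas hh_int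
  have hmain : ∀ y : ℝ, 0 < y →
      IntegrableOn (fun x => x ^ γ * k x y * x) (Ioi (0 : ℝ)) ∧
      ∫ x in Ioi (0 : ℝ), x ^ γ * k x y * x =
        (∫ z in Ioo (0 : ℝ) 1, z ^ (γ + 1) * h z) *
          (y ^ γ + γ * Real.exp (Q y) * ∫ z in Ioi y, z ^ (γ - 1) * Real.exp (-Q z)) := by
    intro y hy
    obtain ⟨h1, h2⟩ := integral_rpow_mul_exp_neg_Ioi hf hf0 hQ hlim hy
      (exp_mul_integral_rpow_mul_exp_neg_Ioi_le hf hf0 hQ hγ hc hR hfR hy).1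
    obtain ⟨h3, h4⟩ := integral_rpow_mul_fragmentation_kernel (κ := fun x => k x y) hh_meas
      hh_nonneg hb hint hf hf0 hmono hy h1 fun x => by
        simp only [hk, div_div, mul_comm (g _)]
    refine ⟨h3, h4.trans ?_⟩
    have h5 : Real.exp (Q y) * Real.exp (-Q y) = 1 := by rw [← Real.exp_add]; simp
    rw [h2, mul_add, mul_left_comm (Real.exp (Q y)) (y ^ γ), h5]
    ring
  have hM0 : 0 ≤ ∫ z in Ioo (0 : ℝ) 1, z ^ (γ + 1) * h z :=
    setIntegral_nonneg measurableSet_Ioo fun z hz =>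
      mul_nonneg (Real.rpow_nonneg hz.1.le _) (hh_nonneg z hz.1 hz.2)
  refine ⟨hlim, fun y hy => ⟨(hmain y hy).1, hint,
    (exp_mul_integral_rpow_mul_exp_neg_Ioi_le hf hf0 hQ hγ hc hR hfR hy).1, (hmain y hy).2⟩,
    _, (∫ z in Ioo (0 : ℝ) 1, z ^ (γ + 1) * h z) * (γ * ((max R₀ 1) ^ γ / γ + 1 / c)), hM0,
    integral_rpow_mul_lt_one hγ hh_meas hh_nonneg hh_int hh_mass hh_ne, by positivity, rfl,
    fun y hy => ?_⟩
  rw [(hmain y hy).2, mul_add, mul_assoc γ]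
  gcongr
  exact (exp_mul_integral_rpow_mul_exp_neg_Ioi_le hf hf0 hQ hγ hc hR hfR hy).2
end

section
/- For every y > 0, ∫₀^∞ k(x,y) x dx = 1, where k(x,y) = ∫_{max(x,y)}^∞ b(x,z) (φ(z)/(z g(z))) e^{Q(y)−Q(z)} dz. (Thus k is the kernel of a stochastic operator on L¹((0,∞), x dx).) -/
open MeasureTheory Filter Set

open Topology

open scoped NNReal

/-- Postcomposition with a Lipschitz function preserves absolute continuity. -/
lemma LipschitzOnWith.comp_absolutelyContinuousOnInterval {X Y : Type*} [PseudoMetricSpace X]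
    [PseudoMetricSpace Y] {F : X → Y} {f : ℝ → X} {K : ℝ≥0} {s : Set X} {a b : ℝ}
    (hF : LipschitzOnWith K F s) (hf : AbsolutelyContinuousOnInterval f a b)
    (hs : MapsTo f (uIcc a b) s) : AbsolutelyContinuousOnInterval (fun x => F (f x)) a b := by
  rw [absolutelyContinuousOnInterval_iff] at hf ⊢
  intro ε hε
  obtain ⟨δ, hδ, h⟩ := hf (ε / (K + 1)) (by positivity)
  refine ⟨δ, hδ, fun E hE hlen => ?_⟩
  have hsum := h E hE hlen
  rw [lt_div_iff₀ (by positivity)] at hsum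
  calc ∑ i ∈ Finset.range E.1, dist (F (f (E.2 i).1)) (F (f (E.2 i).2))
      ≤ ∑ i ∈ Finset.range E.1, K * dist (f (E.2 i).1) (f (E.2 i).2) :=
        Finset.sum_le_sum fun i hi =>
          hF.dist_le_mul _ (hs (hE.1 i hi).1) _ (hs (hE.1 i hi).2)
    _ = K * ∑ i ∈ Finset.range E.1, dist (f (E.2 i).1) (f (E.2 i).2) := by
        rw [Finset.mul_sum]
    _ ≤ (∑ i ∈ Finset.range E.1, dist (f (E.2 i).1) (f (E.2 i).2)) * (K + 1) := by
        have : 0 ≤ ∑ i ∈ Finset.range E.1, dist (f (E.2 i).1) (f (E.2 i).2) :=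
          Finset.sum_nonneg fun _ _ => dist_nonneg
        nlinarith
    _ < ε := hsum

/-- The fundamental theorem of calculus for `x ↦ -exp (-∫_a^x f)`. -/
lemma integral_mul_exp_neg_integral {f : ℝ → ℝ} {a b : ℝ}
    (hf : IntervalIntegrable f volume a b) :
    ∫ x in a..b, f x * Real.exp (-∫ t in a..x, f t) = 1 - Real.exp (-∫ t in a..b, f t) := by
  have hac := hf.absolutelyContinuousOnInterval_intervalIntegral left_mem_uIcc
  obtain ⟨C, hC⟩ := hac.exists_bound
  have hsmooth : ContDiff ℝ 1 fun u : ℝ => -Real.exp (-u) := by fun_prop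
  obtain ⟨K, hK⟩ := hsmooth.contDiffOn.exists_lipschitzOnWith (by decide)
    (convex_Icc (-C) C) isCompact_Icc
  have hcomp := hK.comp_absolutelyContinuousOnInterval hac fun x hx => abs_le.1 (hC x hx)
  have hderiv : ∀ᵐ x, x ∈ uIoc a b →
      f x * Real.exp (-∫ t in a..x, f t) = deriv (fun x => -Real.exp (-∫ t in a..x, f t)) x := by
    filter_upwards [hf.ae_hasDerivAt_integral] with x hx hxab
    have := (hx (uIoc_subset_uIcc hxab) a left_mem_uIcc).neg.exp.neg
    refine Eq.trans ?_ this.deriv.symm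
    simp only [Pi.neg_apply]
    ring
  rw [intervalIntegral.integral_congr_ae hderiv, hcomp.integral_deriv_eq_sub]
  simp
  ring

/-- If the hazard rate `f` has infinite total mass on `(a, ∞)`, then `f x * exp (-∫_a^x f)` is a
probability density there. -/
lemma integrableOn_and_integral_mul_exp_neg_integral {f : ℝ → ℝ} {a : ℝ}
    (hf : LocallyIntegrableOn f (Ici a)) (hf_nonneg : ∀ x, a < x → 0 ≤ f x)
    (hf_top : Tendsto (fun x => ∫ t in a..x, f t) atTop atTop) :
    IntegrableOn (fun x => f x * Real.exp (-∫ t in a..x, f t)) (Ioi a) ∧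
      ∫ x in Ioi a, f x * Real.exp (-∫ t in a..x, f t) = 1 := by
  have hint (b : ℝ) (hb : a ≤ b) : IntervalIntegrable f volume a b :=
    (intervalIntegrable_iff_integrableOn_Icc_of_le hb).2
      (hf.integrableOn_compact_subset Icc_subset_Ici_self isCompact_Icc)
  have hlim : Tendsto (fun b => ∫ x in a..b, f x * Real.exp (-∫ t in a..x, f t)) atTop (𝓝 1) := by
    have h : Tendsto (fun b => 1 - Real.exp (-∫ t in a..b, f t)) atTop (𝓝 (1 - 0)) :=
      (Real.tendsto_exp_neg_atTop_nhds_zero.comp hf_top).const_sub 1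
    rw [sub_zero] at h
    refine h.congr' ?_
    filter_upwards [eventually_ge_atTop a] with b hb
    exact (integral_mul_exp_neg_integral (hint b hb)).symm
  have hprod (b : ℝ) : IntegrableOn (fun x => f x * Real.exp (-∫ t in a..x, f t)) (Ioc a b) := by
    rcases le_total a b with hb | hb
    · have hcont := ((hint b hb).absolutelyContinuousOnInterval_intervalIntegral
        left_mem_uIcc).continuousOn
      exact (intervalIntegrable_iff_integrableOn_Ioc_of_le hb).1
        ((hint b hb).mul_continuousOn (Real.continuous_exp.comp_continuousOn hcont.neg))
    · simp [Ioc_eq_empty_of_le hb]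
  have hI : IntegrableOn (fun x => f x * Real.exp (-∫ t in a..x, f t)) (Ioi a) := by
    refine integrableOn_Ioi_of_intervalIntegral_norm_tendsto 1 a hprod tendsto_id
      (hlim.congr' ?_)
    filter_upwards [eventually_ge_atTop a] with b hb
    refine intervalIntegral.integral_congr_ae (ae_of_all _ fun x hx => ?_)
    rw [uIoc_of_le hb] at hx
    exact (Real.norm_of_nonneg (mul_nonneg (hf_nonneg x hx.1) (Real.exp_pos _).le)).symm
  exact ⟨hI, tendsto_nhds_unique
    (intervalIntegral_tendsto_integral_Ioi a hI tendsto_id) hlim⟩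

/-- For fragmentation with growth, the kernel
`k(x,y) = ∫_{max(x,y)}^∞ b(x,z) (φ(z)/(z g(z))) e^{Q(y)−Q(z)} dz` satisfies
`∫₀^∞ k(x,y) x dx = 1` for every `y > 0`; thus `k` is the kernel of a stochastic operator
on `L¹((0,∞), x dx)`. -/
theorem fragmentation_growth_kernel_stochastic
    (g : ℝ → ℝ) (hg_cont : ContinuousOn g (Ioi (0 : ℝ)))
    (hg_pos : ∀ x : ℝ, 0 < x → 0 < g x)
    (φ : ℝ → ℝ) (hφ_meas : Measurable φ)
    (hφ_nonneg : ∀ x : ℝ, 0 < x → 0 ≤ φ x)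
    (hφg_loc : LocallyIntegrableOn (fun z => φ z / g z) (Ioi (0 : ℝ)))
    (x₁ : ℝ) (hx₁ : 0 < x₁)
    (Q : ℝ → ℝ) (hQ : ∀ x : ℝ, Q x = ∫ z in x₁..x, φ z / g z)
    (hQ_top : Tendsto Q atTop atTop)
    (b : ℝ → ℝ → ℝ)
    (hb_meas : Measurable (Function.uncurry b))
    (hb_nonneg : ∀ x y : ℝ, 0 ≤ b x y)
    (hb_supp : ∀ x y : ℝ, y ≤ x → b x y = 0)
    (hb_mass : ∀ y : ℝ, 0 < y → ∫ x in Ioi (0 : ℝ), b x y * x = y)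
    (k : ℝ → ℝ → ℝ)
    (hk : ∀ x y : ℝ,
      k x y = ∫ z in Ioi (max x y), b x z * (φ z / (z * g z)) * Real.exp (Q y - Q z)) :
    ∀ y : ℝ, 0 < y → ∫ x in Ioi (0 : ℝ), k x y * x = 1 := by
  intro y hy
  have hsub : Ici y ⊆ Ioi (0 : ℝ) := fun z hz => hy.trans_le hz
  have hint {s t : ℝ} (hs : 0 < s) (ht : 0 < t) :
      IntervalIntegrable (fun z => φ z / g z) volume s t :=
    (hφg_loc.integrableOn_compact_subset (fun z hz => (lt_min hs ht).trans_le hz.1)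
      isCompact_uIcc).intervalIntegrable
  have hQ_sub {z : ℝ} (hz : 0 < z) : ∫ t in y..z, φ t / g t = Q z - Q y := by
    rw [hQ, hQ, intervalIntegral.integral_interval_sub_left (hint hx₁ hz) (hint hx₁ hy)]
  obtain ⟨hu_int, hu_one⟩ := integrableOn_and_integral_mul_exp_neg_integral
    (hφg_loc.mono_set hsub)
    (fun z hz => div_nonneg (hφ_nonneg z (hy.trans hz)) (hg_pos z (hy.trans hz)).le)
    ((tendsto_atTop_add_const_right atTop (-Q y) hQ_top).congr' (by
      filter_upwards [eventually_gt_atTop 0] with z hz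
      rw [hQ_sub hz, sub_eq_add_neg]))
  set u : ℝ → ℝ := fun z => φ z / g z * Real.exp (-∫ t in y..z, φ t / g t) with hu
  have hu_nonneg {z : ℝ} (hz : 0 < z) : 0 ≤ u z :=
    mul_nonneg (div_nonneg (hφ_nonneg z hz) (hg_pos z hz).le) (Real.exp_pos _).le
  have hk_eq {x : ℝ} (hx : 0 < x) : k x y * x = ∫ z in Ioi y, b x z * x * (u z / z) := by
    rw [hk, ← integral_mul_const, ← setIntegral_eq_of_subset_of_forall_sdiff_eq_zero
      measurableSet_Ioi (Ioi_subset_Ioi (le_max_right x y))]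
    · refine setIntegral_congr_fun measurableSet_Ioi fun z hz => ?_
      have hz0 : 0 < z := hy.trans hz
      simp only [hu, hQ_sub hz0, neg_sub]
      field_simp
    · intro z hz
      have hzx : z ≤ x := by
        by_contra! h
        exact hz.2 (max_lt h hz.1)
      simp [hb_supp x z hzx]
  have hmass {z : ℝ} (hz : 0 < z) : ∫ x in Ioi 0, b x z * x * (u z / z) = u z := by
    rw [integral_mul_const, hb_mass z hz]
    field_simp
  have hmeas : AEStronglyMeasurable (Function.uncurry fun x z => b x z * x * (u z / z))
      ((volume.restrict (Ioi 0)).prod (volume.restrict (Ioi y))) :=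
    (hb_meas.mul measurable_fst).aestronglyMeasurable.mul
      (hu_int.aemeasurable.div aemeasurable_id).aestronglyMeasurable.comp_snd
  have hF : Integrable (Function.uncurry fun x z => b x z * x * (u z / z))
      ((volume.restrict (Ioi 0)).prod (volume.restrict (Ioi y))) := by
    refine (integrable_prod_iff' hmeas).2 ⟨?_, hu_int.congr ?_⟩
    · filter_upwards [ae_restrict_mem measurableSet_Ioi] with z hz
      have hz0 : 0 < z := hy.trans hz
      have hbz : IntegrableOn (fun x => b x z * x) (Ioi 0) :=
        Integrable.of_integral_ne_zero (by rw [hb_mass z hz0]; exact hz0.ne')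
      exact hbz.mul_const (u z / z)
    · filter_upwards [ae_restrict_mem measurableSet_Ioi] with z hz
      have hz0 : 0 < z := hy.trans hz
      rw [← hmass hz0]
      refine setIntegral_congr_fun measurableSet_Ioi fun x hx => ?_
      exact (Real.norm_of_nonneg (mul_nonneg (mul_nonneg (hb_nonneg x z) (le_of_lt hx))
        (div_nonneg (hu_nonneg hz0) hz0.le))).symm
  calc ∫ x in Ioi 0, k x y * x
      = ∫ x in Ioi 0, ∫ z in Ioi y, b x z * x * (u z / z) :=
        setIntegral_congr_fun measurableSet_Ioi fun x hx => hk_eq hx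
    _ = ∫ z in Ioi y, ∫ x in Ioi 0, b x z * x * (u z / z) := integral_integral_swap hF
    _ = ∫ z in Ioi y, u z :=
        setIntegral_congr_fun measurableSet_Ioi fun z hz => hmass (hy.trans hz)
    _ = 1 := hu_one
end

section
/- Let g : (0,∞) → (0,∞) be continuous and φ : (0,∞) → [0,∞) Borel measurable, with 1/g and φ/g locally integrable on (0,∞) and ∫₀^{x̄} dz/g(z) = ∞ and ∫₀^{x̄} φ(z)/g(z) dz = ∞ for some x̄ > 0. Fix x₀, x₁ > 0 and set G(x) = ∫_x^{x₀} dz/g(z) and Q(x) = ∫_x^{x₁} φ(z)/g(z) dz, so G is strictly decreasing and Q is non-increasing, both continuous, with Q(x) → ∞ as x → 0⁺. For q ∈ ℝ let Q^←(q) = sup{z > 0 : Q(z) ≥ q}. Then for all x > 0 and q > 0, the point y := Q^←(Q(x)+q) satisfies 0 < y < x, and with I := [y, x]: q / sup_{z∈I} φ(z) ≤ G(y) − G(x) ≤ q / inf_{z∈I} φ(z), with the conventions q/∞ = 0 and q/0 = ∞. -/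
open MeasureTheory Filter Set
open scoped ENNReal

theorem MeasureTheory.LocallyIntegrableOn.intervalIntegrable_of_pos {f : ℝ → ℝ}
    (hf : LocallyIntegrableOn f (Ioi (0 : ℝ))) {a b : ℝ} (ha : 0 < a) (hb : 0 < b) :
    IntervalIntegrable f volume a b := by
  rw [intervalIntegrable_iff']
  refine hf.integrableOn_compact_subset (fun z hz => ?_) isCompact_uIcc
  exact (lt_min ha hb).trans_le hz.1

theorem lintegral_Ioc_eq_ofReal_intervalIntegral {f : ℝ → ℝ}
    (hf : LocallyIntegrableOn f (Ioi (0 : ℝ))) (hf0 : ∀ z : ℝ, 0 < z → 0 ≤ f z)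
    {a b : ℝ} (ha : 0 < a) (hab : a ≤ b) :
    ∫⁻ z in Ioc a b, ENNReal.ofReal (f z) = ENNReal.ofReal (∫ z in a..b, f z) := by
  rw [intervalIntegral.integral_of_le hab, ofReal_integral_eq_lintegral_ofReal]
  · exact (hf.intervalIntegrable_of_pos ha (ha.trans_le hab)).1
  · exact (ae_restrict_iff' measurableSet_Ioc).2
      (Eventually.of_forall fun z hz => hf0 z (ha.trans hz.1))

/-- If the integral of a nonnegative function diverges at `0`, then `∫ z in t..x, f z` is
arbitrarily large for small `t`. -/
theorem exists_le_intervalIntegral_of_lintegral_eq_top {f : ℝ → ℝ}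
    (hf : LocallyIntegrableOn f (Ioi (0 : ℝ))) (hf0 : ∀ z : ℝ, 0 < z → 0 ≤ f z)
    {b : ℝ} (hdiv : ∫⁻ z in Ioo (0 : ℝ) b, ENNReal.ofReal (f z) = ⊤)
    {x : ℝ} (hx : 0 < x) (q : ℝ) :
    ∃ t : ℝ, 0 < t ∧ q ≤ ∫ z in t..x, f z := by
  by_contra! h
  have hfi : ∀ n : ℕ, IntegrableOn f (Ioc (x / (n + 1)) x) := fun n =>
    (hf.intervalIntegrable_of_pos (by positivity) hx).1
  have hlim : Tendsto (fun n : ℕ => x / ((n : ℝ) + 1)) atTop (nhds 0) := by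
    simpa [div_eq_mul_inv] using (tendsto_one_div_add_atTop_nhds_zero_nat (𝕜 := ℝ)).const_mul x
  have hint : IntegrableOn f (Ioc 0 x) := by
    refine integrableOn_Ioc_of_intervalIntegral_norm_bounded_left (I := q) hfi hlim
      (Eventually.of_forall fun n => ?_)
    have hpos : 0 < x / ((n : ℝ) + 1) := by positivity
    have hle : x / ((n : ℝ) + 1) ≤ x := div_le_self hx.le (by simp)
    refine le_trans (le_of_eq ?_) (h _ hpos).le
    rw [intervalIntegral.integral_of_le hle]
    exact setIntegral_congr_fun measurableSet_Ioc fun z hz =>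
      Real.norm_of_nonneg (hf0 z (hpos.trans hz.1))
  have hint' : IntegrableOn f (Ioo 0 b) := by
    refine (hint.union (hf.integrableOn_compact_subset (t := Icc x b) (fun z hz => ?_)
      isCompact_Icc)).mono_set fun z hz => ?_
    · exact hx.trans_le hz.1
    · exact (le_total z x).imp (fun h => ⟨hz.1, h⟩) fun h => ⟨h, hz.2.le⟩
  exact hint'.lintegral_lt_top.ne hdiv

/-- The generalized inverse of `t ↦ ∫ z in t..x, f z` at a level `q > 0` is a genuine
preimage of `q` in `(0, x)`. -/
theorem sSup_le_intervalIntegral_spec {f : ℝ → ℝ}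
    (hf : LocallyIntegrableOn f (Ioi (0 : ℝ))) (hf0 : ∀ z : ℝ, 0 < z → 0 ≤ f z)
    {b : ℝ} (hdiv : ∫⁻ z in Ioo (0 : ℝ) b, ENNReal.ofReal (f z) = ⊤)
    {x q : ℝ} (hx : 0 < x) (hq : 0 < q) :
    0 < sSup {t : ℝ | 0 < t ∧ q ≤ ∫ z in t..x, f z} ∧
    sSup {t : ℝ | 0 < t ∧ q ≤ ∫ z in t..x, f z} < x ∧
    ∫ z in sSup {t : ℝ | 0 < t ∧ q ≤ ∫ z in t..x, f z}..x, f z = q := by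
  set S := {t : ℝ | 0 < t ∧ q ≤ ∫ z in t..x, f z} with hS
  obtain ⟨t, ht⟩ : S.Nonempty := exists_le_intervalIntegral_of_lintegral_eq_top hf hf0 hdiv hx q
  have hSx : ∀ t ∈ S, t < x := fun t ht => by
    by_contra! hxt
    have h0 : 0 ≤ ∫ z in x..t, f z :=
      intervalIntegral.integral_nonneg hxt fun z hz => hf0 z (hx.trans_le hz.1)
    have h1 := ht.2
    rw [intervalIntegral.integral_symm] at h1
    linarith
  have hbdd : BddAbove S := ⟨x, fun t ht => (hSx t ht).le⟩
  have hty : t ≤ sSup S := le_csSup hbdd ht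
  have hyx : sSup S ≤ x := csSup_le ⟨t, ht⟩ fun t ht => (hSx t ht).le
  have hcont : ContinuousOn (fun s => ∫ z in s..x, f z) (Icc t x) := by
    have := intervalIntegral.continuousOn_primitive_interval_left (μ := volume) (f := f)
      (a := t) (b := x) (hf.integrableOn_compact_subset
        (fun z hz => (lt_min ht.1 hx).trans_le hz.1) isCompact_uIcc)
    rwa [uIcc_of_le (hty.trans hyx)] at this
  have hyS : sSup S ∈ S := by
    have hclosed : IsClosed (Icc t x ∩ (fun s => ∫ z in s..x, f z) ⁻¹' Ici q) :=
      hcont.preimage_isClosed_of_isClosed isClosed_Icc isClosed_Ici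
    have hsub : S ∩ Ici t ⊆ Icc t x ∩ (fun s => ∫ z in s..x, f z) ⁻¹' Ici q :=
      fun s hs => ⟨⟨hs.2, (hSx s hs.1).le⟩, hs.1.2⟩
    have hlub : IsLUB (S ∩ Ici t) (sSup S) := (isLUB_csSup ⟨t, ht⟩ hbdd).inter_Ici_of_mem ht
    exact ⟨ht.1.trans_le hty,
      (closure_minimal hsub hclosed (hlub.mem_closure ⟨t, ht, self_mem_Ici⟩)).2⟩
  refine ⟨hyS.1, hSx _ hyS, le_antisymm ?_ hyS.2⟩
  obtain ⟨s, hs, hsq⟩ := intermediate_value_Icc' hyx (hcont.mono (Icc_subset_Icc_left hty))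
    (show q ∈ Icc _ _ from ⟨by simpa using hq.le, hyS.2⟩)
  have hs' : s ∈ S := ⟨hyS.1.trans_le hs.1, hsq.ge⟩
  rw [← le_antisymm (le_csSup hbdd hs') hs.1]
  exact hsq.le

/-- For fragmentation with decay, with decreasing primitives
`G(x) = ∫_x^{x₀} dz/g(z)` and `Q(x) = ∫_x^{x₁} φ(z)/g(z) dz`, where
`∫₀^{x̄} dz/g = ∞` and `∫₀^{x̄} φ/g = ∞`, and `Q^←(q) = sup{z > 0 : Q(z) ≥ q}`:
for all `x > 0` and `q > 0`, the point `y = Q^←(Q(x)+q)` satisfies `0 < y < x`, and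
`q / sup_{z∈[y,x]} φ(z) ≤ G(y) − G(x) ≤ q / inf_{z∈[y,x]} φ(z)`
(with the conventions `q/∞ = 0`, `q/0 = ∞`, here expressed in `ℝ≥0∞`). -/
theorem decay_flow_hazard_estimate
    (g : ℝ → ℝ) (hg_cont : ContinuousOn g (Ioi (0 : ℝ)))
    (hg_pos : ∀ x : ℝ, 0 < x → 0 < g x)
    (φ : ℝ → ℝ) (hφ_meas : Measurable φ)
    (hφ_nonneg : ∀ x : ℝ, 0 < x → 0 ≤ φ x)
    (hg_loc : LocallyIntegrableOn (fun z => (g z)⁻¹) (Ioi (0 : ℝ)))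
    (hφg_loc : LocallyIntegrableOn (fun z => φ z / g z) (Ioi (0 : ℝ)))
    (xbar : ℝ) (hxbar : 0 < xbar)
    (hg_div : ∫⁻ z in Ioo (0 : ℝ) xbar, ENNReal.ofReal ((g z)⁻¹) = ⊤)
    (hφg_div : ∫⁻ z in Ioo (0 : ℝ) xbar, ENNReal.ofReal (φ z / g z) = ⊤)
    (x₀ : ℝ) (hx₀ : 0 < x₀) (x₁ : ℝ) (hx₁ : 0 < x₁)
    (G : ℝ → ℝ) (hG : ∀ x : ℝ, G x = ∫ z in x..x₀, (g z)⁻¹)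
    (Q : ℝ → ℝ) (hQ : ∀ x : ℝ, Q x = ∫ z in x..x₁, φ z / g z) :
    ∀ x : ℝ, 0 < x → ∀ q : ℝ, 0 < q →
      0 < sSup {z : ℝ | 0 < z ∧ Q x + q ≤ Q z} ∧
      sSup {z : ℝ | 0 < z ∧ Q x + q ≤ Q z} < x ∧
      ENNReal.ofReal q /
          (⨆ z ∈ Icc (sSup {z : ℝ | 0 < z ∧ Q x + q ≤ Q z}) x, ENNReal.ofReal (φ z)) ≤
        ENNReal.ofReal (G (sSup {z : ℝ | 0 < z ∧ Q x + q ≤ Q z}) - G x) ∧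
      ENNReal.ofReal (G (sSup {z : ℝ | 0 < z ∧ Q x + q ≤ Q z}) - G x) ≤
        ENNReal.ofReal q /
          (⨅ z ∈ Icc (sSup {z : ℝ | 0 < z ∧ Q x + q ≤ Q z}) x, ENNReal.ofReal (φ z)) := by
  intro x hx q hq
  have hf0 : ∀ z : ℝ, 0 < z → 0 ≤ φ z / g z := fun z hz =>
    div_nonneg (hφ_nonneg z hz) (hg_pos z hz).le
  have hg0 : ∀ z : ℝ, 0 < z → 0 ≤ (g z)⁻¹ := fun z hz => (inv_pos.2 (hg_pos z hz)).le
  have hset : {z : ℝ | 0 < z ∧ Q x + q ≤ Q z} =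
      {t : ℝ | 0 < t ∧ q ≤ ∫ z in t..x, φ z / g z} := by
    ext t
    refine and_congr_right fun ht => ?_
    rw [hQ, hQ, ← intervalIntegral.integral_add_adjacent_intervals
      (hφg_loc.intervalIntegrable_of_pos ht hx) (hφg_loc.intervalIntegrable_of_pos hx hx₁),
      add_comm, add_le_add_iff_right]
  obtain ⟨hy, hyx, hyq⟩ := sSup_le_intervalIntegral_spec hφg_loc hf0 hφg_div hx hq
  rw [hset]
  set y := sSup {t : ℝ | 0 < t ∧ q ≤ ∫ z in t..x, φ z / g z}
  have hGyx : G y - G x = ∫ z in y..x, (g z)⁻¹ := by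
    rw [hG, hG, ← intervalIntegral.integral_add_adjacent_intervals
      (hg_loc.intervalIntegrable_of_pos hy hx) (hg_loc.intervalIntegrable_of_pos hx hx₀),
      add_sub_cancel_right]
  have hLq : ∫⁻ z in Ioc y x, ENNReal.ofReal (φ z / g z) = ENNReal.ofReal q := by
    rw [lintegral_Ioc_eq_ofReal_intervalIntegral hφg_loc hf0 hy hyx.le, hyq]
  have hmul : ∀ z ∈ Ioc y x, ENNReal.ofReal (φ z / g z) =
      ENNReal.ofReal (φ z) * ENNReal.ofReal ((g z)⁻¹) := fun z hz => by
    rw [div_eq_mul_inv, ENNReal.ofReal_mul (hφ_nonneg z (hy.trans hz.1))]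
  have hmeas : AEMeasurable (fun z => ENNReal.ofReal ((g z)⁻¹)) (volume.restrict (Ioc y x)) :=
    (hg_loc.intervalIntegrable_of_pos hy hx).1.aemeasurable.ennreal_ofReal
  refine ⟨hy, hyx, ?_, ?_⟩
  · refine ENNReal.div_le_of_le_mul' ?_
    rw [hGyx, ← hLq, ← lintegral_Ioc_eq_ofReal_intervalIntegral hg_loc hg0 hy hyx.le,
      ← lintegral_const_mul'' _ hmeas]
    refine setLIntegral_mono' measurableSet_Ioc fun z hz => ?_
    rw [hmul z hz]
    gcongr
    exact le_iSup₂ (f := fun z (_ : z ∈ Icc y x) => ENNReal.ofReal (φ z)) z ⟨hz.1.le, hz.2⟩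
  · rw [ENNReal.le_div_iff_mul_le (Or.inr (ENNReal.ofReal_pos.2 hq).ne')
      (Or.inr ENNReal.ofReal_ne_top), mul_comm, hGyx, ← hLq,
      ← lintegral_Ioc_eq_ofReal_intervalIntegral hg_loc hg0 hy hyx.le,
      ← lintegral_const_mul'' _ hmeas]
    refine setLIntegral_mono' measurableSet_Ioc fun z hz => ?_
    rw [hmul z hz]
    gcongr
    exact iInf₂_le (f := fun z (_ : z ∈ Icc y x) => ENNReal.ofReal (φ z)) z ⟨hz.1.le, hz.2⟩
end
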